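/- For every graph H and every positive integer r, the class of all graphs G such that G is K_{r,r}-free and no subdivision of H is isomorphic to an induced subgraph of G has ω-bounded expansion. -/

import Mathlib

open SimpleGraph

/-! ## Basic containment relations between graphs -/

/-- `H` is isomorphic to a (not necessarily induced) subgraph of `G`. -/
def IsSubgraphOf {V W : Type*} (H : SimpleGraph V) (G : SimpleGraph W) : Prop :=
  ∃ f : H →g G, Function.Injective f

/-- `H` is isomorphic to an induced subgraph of `G`. -/
def IsInducedSubgraphOf {V W : Type*} (H : SimpleGraph V) (G : SimpleGraph W) : Prop :=
  Nonempty (H ↪g G)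

/-- The clique number `ω(G)`: the largest `m` such that `K_m` is a subgraph of `G`. -/
noncomputable def omegaNum {V : Type*} (G : SimpleGraph V) : ℕ :=
  sSup {m | IsSubgraphOf (⊤ : SimpleGraph (Fin m)) G}

/-- The chromatic number `χ(G)` (as a natural number). -/
noncomputable def chi {V : Type*} (G : SimpleGraph V) : ℕ :=
  sInf {N | G.Colorable N}

/-! ## Tree-depth and the invariants `χ_p` -/

/-- A forest order: a partial order in which the down-set of every element is a chain.
Such orders are exactly the ancestor orders of rooted forests. -/
def IsForestOrder {V : Type*} (r : V → V → Prop) : Prop :=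
  (∀ v, r v v) ∧ (∀ u v, r u v → r v u → u = v) ∧
  (∀ u v w, r u v → r v w → r u w) ∧
  (∀ u v w, r u w → r v w → r u v ∨ r v u)

/-- `G` has tree-depth at most `h`: `G` is a subgraph of the closure of a rooted forest
of height at most `h` (height = maximum number of vertices on a root-to-leaf path). -/
def TreeDepthLE {V : Type*} (G : SimpleGraph V) (h : ℕ) : Prop :=
  ∃ r : V → V → Prop, IsForestOrder r ∧
    (∀ u v, G.Adj u v → r u v ∨ r v u) ∧
    (∀ v, {u | r u v}.ncard ≤ h)

/-- The tree-depth `td(G)`. -/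
noncomputable def treeDepth {V : Type*} (G : SimpleGraph V) : ℕ :=
  sInf {h | TreeDepthLE G h}

/-- `χ_p(G)`: the least number of colors of a vertex coloring such that every set `I` of at
most `p` colors induces a subgraph of tree-depth at most `|I|`. -/
noncomputable def chiP {V : Type*} (G : SimpleGraph V) (p : ℕ) : ℕ :=
  sInf {N | ∃ c : V → Fin N, ∀ I : Finset (Fin N), I.card ≤ p →
    TreeDepthLE (G.induce {v | c v ∈ I}) I.card}

/-! ## Star colorings -/

/-- A star coloring: a proper coloring with no path on `4` vertices using only two colors. -/
def IsStarColoring {V α : Type*} (G : SimpleGraph V) (c : V → α) : Prop :=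
  (∀ u v, G.Adj u v → c u ≠ c v) ∧
  ∀ x y z w : V, G.Adj x y → G.Adj y z → G.Adj z w →
    x ≠ z → y ≠ w → x ≠ w → ¬(c x = c z ∧ c y = c w)

/-- The star chromatic number `χ_s(G)`. -/
noncomputable def starChi {V : Type*} (G : SimpleGraph V) : ℕ :=
  sInf {N | ∃ c : V → Fin N, IsStarColoring G c}

/-! ## Subdivisions -/

/-- The edges of a graph on `Fin n`, presented as increasingly ordered pairs. -/
def Edges {n : ℕ} (H : SimpleGraph (Fin n)) : Type :=
  {p : Fin n × Fin n // p.1 < p.2 ∧ H.Adj p.1 p.2}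

/-- Base relation of the subdivision of `H`, where the edge `e` receives `t e` internal
vertices. -/
def subdivRel {n : ℕ} (H : SimpleGraph (Fin n)) (t : Edges H → ℕ) :
    (Fin n ⊕ Σ e : Edges H, Fin (t e)) → (Fin n ⊕ Σ e : Edges H, Fin (t e)) → Prop
  | Sum.inl u, Sum.inl v => ∃ h : u < v ∧ H.Adj u v, t ⟨(u, v), h⟩ = 0
  | Sum.inl u, Sum.inr ⟨e, i⟩ =>
      (u = e.1.1 ∧ (i : ℕ) = 0) ∨ (u = e.1.2 ∧ (i : ℕ) + 1 = t e)
  | Sum.inr ⟨e, i⟩, Sum.inr ⟨e', j⟩ => e = e' ∧ (i : ℕ) + 1 = (j : ℕ)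
  | _, _ => False

/-- The subdivision of `H` in which each edge `e` is replaced by a path with exactly `t e`
internal vertices. In particular `Subdiv H (fun _ => r)` is the `r`-subdivision `H^{(r)}`,
and the `(≤ r)`-subdivisions of `H` are the graphs `Subdiv H t` with `t e ≤ r` for all `e`. -/
def Subdiv {n : ℕ} (H : SimpleGraph (Fin n)) (t : Edges H → ℕ) :
    SimpleGraph (Fin n ⊕ Σ e : Edges H, Fin (t e)) :=
  SimpleGraph.fromRel (subdivRel H t)

/-- `H ∈ TM_r(G)`: some `(≤ r)`-subdivision of `H` is a subgraph of `G`. -/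
def MemTM {W : Type*} (r : ℕ) (G : SimpleGraph W) {n : ℕ} (H : SimpleGraph (Fin n)) : Prop :=
  ∃ t : Edges H → ℕ, (∀ e, t e ≤ r) ∧ IsSubgraphOf (Subdiv H t) G

/-- `H ∈ ITM_r^e(G)`: the exact `r`-subdivision of `H` is an induced subgraph of `G`. -/
def MemITM {W : Type*} (r : ℕ) (G : SimpleGraph W) {n : ℕ} (H : SimpleGraph (Fin n)) : Prop :=
  IsInducedSubgraphOf (Subdiv H (fun _ => r)) G

/-- `ω(TM_r(G))`: the supremum of the clique numbers of the graphs in `TM_r(G)`. -/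
noncomputable def omegaTM {W : Type*} (r : ℕ) (G : SimpleGraph W) : ℕ :=
  sSup {m | ∃ (k : ℕ) (H : SimpleGraph (Fin k)), MemTM r G H ∧ omegaNum H = m}

/-- The biclique number `bω(G)`: the largest `s` with `K_{s,s}` a subgraph of `G`. -/
noncomputable def bomega {V : Type*} (G : SimpleGraph V) : ℕ :=
  sSup {s | IsSubgraphOf (completeBipartiteGraph (Fin s) (Fin s)) G}

/-- The average degree `d̄(G) = 2|E(G)|/|V(G)|`. -/
noncomputable def avgDeg {n : ℕ} (G : SimpleGraph (Fin n)) : ℝ :=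
  2 * (G.edgeSet.ncard : ℝ) / n

/-! ## Classes of graphs -/

/-- A class of (finite, simple) graphs: for each `n`, a set of graphs on `Fin n`.
Classes are implicitly closed under isomorphism via the relations used below. -/
def GraphClass := ∀ n : ℕ, Set (SimpleGraph (Fin n))

/-- A hereditary class: closed under induced subgraphs (hence under isomorphism). -/
def Hereditary (C : GraphClass) : Prop :=
  ∀ ⦃n m : ℕ⦄ (G : SimpleGraph (Fin n)) (H : SimpleGraph (Fin m)),
    G ∈ C n → IsInducedSubgraphOf H G → H ∈ C m

/-- A monotone class: closed under subgraphs (hence under isomorphism). -/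
def MonotoneClass (C : GraphClass) : Prop :=
  ∀ ⦃n m : ℕ⦄ (G : SimpleGraph (Fin n)) (H : SimpleGraph (Fin m)),
    G ∈ C n → IsSubgraphOf H G → H ∈ C m

/-- `H ∈ TM_r(𝒞)`. -/
def MemTMClass (r : ℕ) (C : GraphClass) {m : ℕ} (H : SimpleGraph (Fin m)) : Prop :=
  ∃ (n : ℕ) (G : SimpleGraph (Fin n)), G ∈ C n ∧ MemTM r G H

/-- `H ∈ ITM_r^e(𝒞)`. -/
def MemITMClass (r : ℕ) (C : GraphClass) {m : ℕ} (H : SimpleGraph (Fin m)) : Prop :=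
  ∃ (n : ℕ) (G : SimpleGraph (Fin n)), G ∈ C n ∧ MemITM r G H

/-- `𝒞` is `χ`-bounded: `χ(H) ≤ f(ω(H))` for every induced subgraph `H` of a graph of `𝒞`. -/
def ChiBounded (C : GraphClass) : Prop :=
  ∃ f : ℕ → ℕ, ∀ ⦃n : ℕ⦄ (G : SimpleGraph (Fin n)), G ∈ C n →
    ∀ ⦃m : ℕ⦄ (H : SimpleGraph (Fin m)), IsInducedSubgraphOf H G →
      chi H ≤ f (omegaNum H)

/-- `𝒞` has bounded expansion: for every `r`, `d̄(TM_r(𝒞)) < ∞`. -/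
def BoundedExpansion (C : GraphClass) : Prop :=
  ∀ r : ℕ, ∃ d : ℝ, ∀ ⦃m : ℕ⦄ (H : SimpleGraph (Fin m)), MemTMClass r C H → avgDeg H ≤ d

/-- `𝒞` has `ω`-bounded expansion. -/
def OmegaBoundedExpansion (C : GraphClass) : Prop :=
  ∃ f : ℕ → ℕ → ℝ, ∀ ⦃n : ℕ⦄ (G : SimpleGraph (Fin n)), G ∈ C n →
    ∀ (r : ℕ) ⦃m : ℕ⦄ (H : SimpleGraph (Fin m)), MemTM r G H →
      avgDeg H ≤ f (omegaNum G) r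

/-- `𝒞` is nowhere dense: for every `r`, `ω(TM_r(𝒞)) < ∞`. -/
def NowhereDense (C : GraphClass) : Prop :=
  ∀ r : ℕ, ∃ c : ℕ, ∀ ⦃m : ℕ⦄ (H : SimpleGraph (Fin m)), MemTMClass r C H → omegaNum H ≤ c

/-- `𝒞` is strongly `χ_p`-bounded: `χ_p(G) ≤ f_p(ω(G))` on `𝒞`. -/
def StronglyChiPBounded (C : GraphClass) (p : ℕ) : Prop :=
  ∃ f : ℕ → ℕ, ∀ ⦃n : ℕ⦄ (G : SimpleGraph (Fin n)), G ∈ C n → chiP G p ≤ f (omegaNum G)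

/-- `𝒞` is weakly `χ_p`-bounded: `χ_p(G) ≤ g_p(ω(TM_{p-1}(G)))` on `𝒞`. -/
def WeaklyChiPBounded (C : GraphClass) (p : ℕ) : Prop :=
  ∃ g : ℕ → ℕ, ∀ ⦃n : ℕ⦄ (G : SimpleGraph (Fin n)), G ∈ C n → chiP G p ≤ g (omegaTM (p - 1) G)

/-! ## Directed graphs, orientations and restricted dualities -/

/-- Existence of a homomorphism between directed graphs presented as binary relations. -/
def DigraphHomEx {n m : ℕ} (A : Fin n → Fin n → Prop) (B : Fin m → Fin m → Prop) : Prop :=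
  ∃ f : Fin n → Fin m, ∀ u v, A u v → B (f u) (f v)

/-- `A` is an orientation of the graph `G`. -/
def IsOrientationOf {n : ℕ} (A : Fin n → Fin n → Prop) (G : SimpleGraph (Fin n)) : Prop :=
  (∀ u v, ¬(A u v ∧ A v u)) ∧ (∀ u v, G.Adj u v ↔ (A u v ∨ A v u))

/-- A directed graph is acyclic if it has no directed cycle. -/
def IsAcyclicDigraph {n : ℕ} (A : Fin n → Fin n → Prop) : Prop :=
  ∀ v, ¬ Relation.TransGen A v v

/-- The directed graph `F` has a restricted dual for the class of all orientations of the
graphs of `𝒞`. -/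
def HasRestrictedDualForOrientations (C : GraphClass) {nF : ℕ}
    (F : Fin nF → Fin nF → Prop) : Prop :=
  ∃ (m : ℕ) (D : Fin m → Fin m → Prop),
    ¬ DigraphHomEx F D ∧
    ∀ ⦃n : ℕ⦄ (A : Fin n → Fin n → Prop) (G : SimpleGraph (Fin n)),
      G ∈ C n → IsOrientationOf A G →
      (¬ DigraphHomEx F A ↔ DigraphHomEx A D)

/-! ## Holes -/

/-- The number `h_g(G)` of holes of length `g` in `G`, i.e. of vertex subsets inducing a
cycle on `g` vertices. -/
noncomputable def holeCount {n : ℕ} (g : ℕ) (G : SimpleGraph (Fin n)) : ℕ :=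
  {S : Set (Fin n) | Nonempty (G.induce S ≃g SimpleGraph.cycleGraph g)}.ncard

/-- `G` is even hole-free: it has no induced cycle of even length at least `4`. -/
def EvenHoleFree {n : ℕ} (G : SimpleGraph (Fin n)) : Prop :=
  ∀ g : ℕ, 4 ≤ g → Even g → holeCount g G = 0

section Auxiliary

open scoped Classical BigOperators

/-! ## Auxiliary notions -/

section Counting

variable {V : Type}

/-- The neighbours of `v` inside `W`. -/
noncomputable def nbrIn (G : SimpleGraph V) (W : Finset V) (v : V) : Finset V :=
  W.filter (fun w => G.Adj v w)

lemma mem_nbrIn {G : SimpleGraph V} {W : Finset V} {v w : V} :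
    w ∈ nbrIn G W v ↔ w ∈ W ∧ G.Adj v w := by
  simp [nbrIn]

/-- Twice the number of edges of `G` inside `W`. -/
noncomputable def degSum (G : SimpleGraph V) (W : Finset V) : ℕ :=
  ∑ v ∈ W, (nbrIn G W v).card

/-- `G` contains `K_{s,s}` as a (not necessarily induced) subgraph. -/
def HasBiclique (G : SimpleGraph V) (s : ℕ) : Prop :=
  ∃ S T : Finset V, S.card = s ∧ T.card = s ∧ ∀ x ∈ S, ∀ y ∈ T, G.Adj x y

lemma exists_clique_or_indep (a b : ℕ) : ∃ R : ℕ, ∀ {V : Type} (G : SimpleGraph V) (X : Finset V),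
    R ≤ X.card → (∃ S ⊆ X, S.card = a ∧ ∀ x ∈ S, ∀ y ∈ S, x ≠ y → G.Adj x y) ∨
      (∃ S ⊆ X, S.card = b ∧ ∀ x ∈ S, ∀ y ∈ S, ¬ G.Adj x y) := by
  induction a generalizing b with
  | zero => exact ⟨0, fun G X _ => Or.inl ⟨∅, by simp, by simp, by simp⟩⟩
  | succ a iha =>
    induction b with
    | zero => exact ⟨0, fun G X _ => Or.inr ⟨∅, by simp, by simp, by simp⟩⟩
    | succ b ihb =>
      obtain ⟨R₁, h₁⟩ := iha (b + 1)
      obtain ⟨R₂, h₂⟩ := ihb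
      refine ⟨R₁ + R₂ + 1, fun {V} G X hX => ?_⟩
      obtain ⟨v, hv⟩ : X.Nonempty := Finset.card_pos.1 (by omega)
      have hsplit := Finset.card_filter_add_card_filter_not (s := X.erase v)
        (fun w => G.Adj v w)
      rw [Finset.card_erase_of_mem hv] at hsplit
      rcases le_or_gt R₁ ((X.erase v).filter (fun w => G.Adj v w)).card with h | h
      · rcases h₁ G _ h with ⟨S, hS, hc, hcl⟩ | ⟨S, hS, hc, hin⟩
        · left
          have hvS : v ∉ S := fun h => by simpa using hS h
          refine ⟨insert v S, ?_, by rw [Finset.card_insert_of_notMem hvS, hc], ?_⟩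
          · intro x hx
            rcases Finset.mem_insert.1 hx with rfl | hx
            · exact hv
            · exact Finset.mem_of_mem_erase (Finset.mem_filter.1 (hS hx)).1
          · intro x hx y hy hxy
            rcases Finset.mem_insert.1 hx with rfl | hx' <;> rcases Finset.mem_insert.1 hy with rfl | hy'
            · exact absurd rfl hxy
            · exact (Finset.mem_filter.1 (hS hy')).2
            · exact ((Finset.mem_filter.1 (hS hx')).2).symm
            · exact hcl x hx' y hy' hxy
        · right
          exact ⟨S, fun x hx => Finset.mem_of_mem_erase (Finset.mem_filter.1 (hS hx)).1, hc, hin⟩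
      · have h : R₂ ≤ ((X.erase v).filter (fun w => ¬ G.Adj v w)).card := by omega
        rcases h₂ G _ h with ⟨S, hS, hc, hcl⟩ | ⟨S, hS, hc, hin⟩
        · left
          exact ⟨S, fun x hx => Finset.mem_of_mem_erase (Finset.mem_filter.1 (hS hx)).1, hc, hcl⟩
        · right
          have hvS : v ∉ S := fun h => by simpa using hS h
          refine ⟨insert v S, ?_, by rw [Finset.card_insert_of_notMem hvS, hc], ?_⟩
          · intro x hx
            rcases Finset.mem_insert.1 hx with rfl | hx
            · exact hv
            · exact Finset.mem_of_mem_erase (Finset.mem_filter.1 (hS hx)).1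
          · intro x hx y hy
            rcases Finset.mem_insert.1 hx with rfl | hx' <;> rcases Finset.mem_insert.1 hy with rfl | hy'
            · exact G.loopless.irrefl _
            · exact (Finset.mem_filter.1 (hS hy')).2
            · exact fun h => (Finset.mem_filter.1 (hS hx')).2 h.symm
            · exact hin x hx' y hy'

/-- In a degenerate graph there are small out-neighbourhoods such that every clique is contained
in a closed out-neighbourhood of one of its vertices. -/
lemma exists_out [Fintype V] (G : SimpleGraph V) (D : ℕ)
    (h : ∀ W : Finset V, W.Nonempty → ∃ v ∈ W, (nbrIn G W v).card ≤ D) :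
    ∃ out : V → Finset V, (∀ v, (out v).card ≤ D) ∧
      ∀ T : Finset V, T.Nonempty → (∀ x ∈ T, ∀ y ∈ T, x ≠ y → G.Adj x y) →
        ∃ w ∈ T, T.erase w ⊆ out w := by
  suffices H : ∀ n : ℕ, ∀ W : Finset V, W.card = n → ∃ out : V → Finset V,
      (∀ v, (out v).card ≤ D) ∧
      ∀ T ⊆ W, T.Nonempty → (∀ x ∈ T, ∀ y ∈ T, x ≠ y → G.Adj x y) →
        ∃ w ∈ T, T.erase w ⊆ out w by
    obtain ⟨out, h₁, h₂⟩ := H _ Finset.univ rfl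
    exact ⟨out, h₁, fun T => h₂ T (Finset.subset_univ _)⟩
  intro n
  induction n with
  | zero =>
    intro W hW
    refine ⟨fun _ => ∅, by simp, fun T hT hne => ?_⟩
    rw [Finset.card_eq_zero] at hW
    subst hW
    rw [Finset.subset_empty] at hT
    simp [hT] at hne
  | succ n ih =>
    intro W hW
    obtain ⟨v, hv, hd⟩ := h W (Finset.card_pos.1 (by omega))
    obtain ⟨out, h₁, h₂⟩ := ih (W.erase v) (by rw [Finset.card_erase_of_mem hv]; omega)
    refine ⟨Function.update out v (nbrIn G W v), ?_, ?_⟩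
    · intro x
      by_cases hx : x = v
      · subst hx; simpa using hd
      · simpa [hx] using h₁ x
    · intro T hT hne hcl
      by_cases hvT : v ∈ T
      · refine ⟨v, hvT, ?_⟩
        intro x hx
        rw [Finset.mem_erase] at hx
        simpa [mem_nbrIn] using ⟨hT hx.2, hcl v hvT x hx.2 (Ne.symm hx.1)⟩
      · obtain ⟨w, hw, hs⟩ := h₂ T (fun x hx => Finset.mem_erase.2
          ⟨fun h => hvT (h ▸ hx), hT hx⟩) hne hcl
        refine ⟨w, hw, ?_⟩
        have : w ≠ v := fun h => hvT (h ▸ hw)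
        simpa [this] using hs

lemma exists_out_adj {G : SimpleGraph V} {out : V → Finset V}
    (h : ∀ T : Finset V, T.Nonempty → (∀ x ∈ T, ∀ y ∈ T, x ≠ y → G.Adj x y) →
        ∃ w ∈ T, T.erase w ⊆ out w) {x y : V} (hxy : G.Adj x y) : y ∈ out x ∨ x ∈ out y := by
  obtain ⟨w, hw, hs⟩ := h {x, y} (by simp) (by
    intro a ha b hb hab
    simp only [Finset.mem_insert, Finset.mem_singleton] at ha hb
    rcases ha with rfl | rfl <;> rcases hb with rfl | rfl
    · exact absurd rfl hab
    · exact hxy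
    · exact hxy.symm
    · exact absurd rfl hab)
  simp only [Finset.mem_insert, Finset.mem_singleton] at hw
  rcases hw with rfl | rfl
  · left; exact hs (by simp [hxy.ne'])
  · right; exact hs (by simp [hxy.ne])

/-- A graph all of whose subgraphs have bounded average degree is degenerate. -/
lemma exists_low_degree {G : SimpleGraph V} {D : ℕ} {W : Finset V} (hW : W.Nonempty)
    (h : degSum G W ≤ D * W.card) : ∃ v ∈ W, (nbrIn G W v).card ≤ D := by
  by_contra! hc
  have : ∑ v ∈ W, D < ∑ v ∈ W, (nbrIn G W v).card :=
    Finset.sum_lt_sum_of_nonempty hW hc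
  simp only [Finset.sum_const, smul_eq_mul] at this
  unfold degSum at h
  nlinarith

lemma degSum_erase (G : SimpleGraph V) {W : Finset V} {v : V} (hv : v ∈ W) :
    degSum G W = degSum G (W.erase v) + 2 * (nbrIn G W v).card := by
  have h1 : ∀ w ∈ W.erase v, (nbrIn G W w).card =
      (nbrIn G (W.erase v) w).card + if G.Adj v w then 1 else 0 := by
    intro w hw
    rw [Finset.mem_erase] at hw
    split_ifs with h
    · have : nbrIn G W w = insert v (nbrIn G (W.erase v) w) := by
        ext x
        simp only [Finset.mem_insert, mem_nbrIn, Finset.mem_erase]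
        constructor
        · rintro ⟨h1, h2⟩
          by_cases hx : x = v
          · exact Or.inl hx
          · exact Or.inr ⟨⟨hx, h1⟩, h2⟩
        · rintro (rfl | ⟨⟨_, h1⟩, h2⟩)
          · exact ⟨hv, h.symm⟩
          · exact ⟨h1, h2⟩
      rw [this, Finset.card_insert_of_notMem (by simp [mem_nbrIn])]
    · have : nbrIn G W w = nbrIn G (W.erase v) w := by
        ext x
        simp only [mem_nbrIn, Finset.mem_erase]
        constructor
        · rintro ⟨h1, h2⟩
          exact ⟨⟨fun hx => h (hx ▸ h2.symm), h1⟩, h2⟩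
        · rintro ⟨⟨_, h1⟩, h2⟩
          exact ⟨h1, h2⟩
      rw [this, add_zero]
  have h2 : (nbrIn G W v).card = ∑ w ∈ W.erase v, if G.Adj v w then 1 else 0 := by
    rw [Finset.sum_ite, Finset.sum_const_zero, add_zero, Finset.sum_const, smul_eq_mul, mul_one]
    congr 1
    ext x
    simp only [mem_nbrIn, Finset.mem_filter, Finset.mem_erase]
    exact ⟨fun h => ⟨⟨h.2.ne', h.1⟩, h.2⟩, fun h => ⟨h.1.2, h.2⟩⟩
  unfold degSum
  rw [← Finset.add_sum_erase _ _ hv, Finset.sum_congr rfl h1, Finset.sum_add_distrib, ← h2]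
  ring

end Counting

/-! ## Random sampling -/

section Sampling

variable {X : Type} [Fintype X] {N : ℕ}

lemma expect_forall_zero [NeZero N] (P : Finset X) :
    Finset.expect Finset.univ (fun f : X → Fin N => if ∀ x ∈ P, f x = 0 then (1 : ℝ) else 0)
      = (1 / (N : ℝ)) ^ P.card := by
  have hN : (N : ℝ) ≠ 0 := Nat.cast_ne_zero.2 (NeZero.ne N)
  rw [Finset.expect_eq_sum_div_card, Finset.sum_boole]
  have h1 : (Finset.univ.filter (fun f : X → Fin N => ∀ x ∈ P, f x = 0)) =
      Fintype.piFinset (fun x => if x ∈ P then ({0} : Finset (Fin N)) else Finset.univ) := by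
    ext f
    simp only [Finset.mem_filter, Finset.mem_univ, true_and, Fintype.mem_piFinset]
    refine forall_congr' fun x => ?_
    split_ifs with h <;> simp [h]
  have h2 : ∀ x, (if x ∈ P then ({0} : Finset (Fin N)) else Finset.univ).card =
      if x ∈ P then 1 else N := by
    intro x; split_ifs <;> simp
  rw [h1, Fintype.card_piFinset]
  simp only [h2]
  rw [Finset.prod_ite, Finset.prod_const_one, one_mul, Finset.prod_const]
  have h3 : (Finset.univ.filter (fun x => x ∉ P)).card = Fintype.card X - P.card := by
    rw [← Finset.card_compl]
    congr 1
    ext; simp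
  have h4 : P.card ≤ Fintype.card X := Finset.card_le_univ P
  rw [h3, Finset.card_univ, Fintype.card_fun, Fintype.card_fin]
  push_cast
  rw [div_eq_iff (by positivity), one_div, inv_pow, ← div_eq_inv_mul, eq_div_iff (by positivity),
    ← pow_add, Nat.sub_add_cancel h4]

lemma expect_good_ge [NeZero N] (P B : Finset X) (hPB : Disjoint P B) :
    (1 / (N : ℝ)) ^ P.card * (1 - B.card / N) ≤
    Finset.expect Finset.univ (fun f : X → Fin N =>
      if (∀ x ∈ P, f x = 0) ∧ ∀ x ∈ B, f x ≠ 0 then (1 : ℝ) else 0) := by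
  have key : ∀ f : X → Fin N, (if ∀ x ∈ P, f x = 0 then (1 : ℝ) else 0) -
      ∑ b ∈ B, (if ∀ x ∈ insert b P, f x = 0 then (1 : ℝ) else 0) ≤
      (if (∀ x ∈ P, f x = 0) ∧ ∀ x ∈ B, f x ≠ 0 then (1 : ℝ) else 0) := by
    intro f
    have hnn : ∀ b ∈ B, (0 : ℝ) ≤ (if ∀ x ∈ insert b P, f x = 0 then (1 : ℝ) else 0) := by
      intro b _; split_ifs <;> norm_num
    by_cases h1 : ∀ x ∈ P, f x = 0
    · by_cases h2 : ∀ x ∈ B, f x ≠ 0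
      · rw [if_pos h1, if_pos ⟨h1, h2⟩]
        linarith [Finset.sum_nonneg hnn]
      · rw [if_pos h1, if_neg (fun h => h2 h.2)]
        push Not at h2
        obtain ⟨b, hb, hfb⟩ := h2
        have := Finset.single_le_sum hnn hb
        rw [if_pos (by
          intro x hx
          rcases Finset.mem_insert.1 hx with rfl | hx
          · exact hfb
          · exact h1 x hx)] at this
        linarith
    · rw [if_neg h1, if_neg (fun h => h1 h.1)]
      linarith [Finset.sum_nonneg hnn]
  have h := Finset.expect_le_expect (s := Finset.univ) (fun f _ => key f)
  refine le_trans (le_of_eq ?_) h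
  rw [Finset.expect_sub_distrib, Finset.expect_sum_comm, expect_forall_zero]
  have : ∀ b ∈ B, Finset.expect Finset.univ (fun f : X → Fin N =>
      if ∀ x ∈ insert b P, f x = 0 then (1 : ℝ) else 0) = (1 / (N : ℝ)) ^ (P.card + 1) := by
    intro b hb
    rw [expect_forall_zero, Finset.card_insert_of_notMem]
    exact fun h => Finset.disjoint_left.1 hPB h hb
  rw [Finset.sum_congr rfl this, Finset.sum_const, nsmul_eq_mul, pow_succ]
  ring

lemma exists_pos_of_expect_pos (g : (X → Fin N) → ℝ)
    (h : 0 < Finset.expect Finset.univ g) : ∃ f, 0 < g f := by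
  by_contra! hc
  have := Finset.expect_le_expect (s := Finset.univ) (fun f _ => hc f)
  rw [Finset.expect_const_zero] at this
  linarith

end Sampling

/-! ## Induced models -/

section InducedModels

variable {V ι : Type}

/-- `u` and `v` are joined by a walk of `G` whose internal vertices lie in `X`. -/
def Linked (G : SimpleGraph V) (X : Set V) (u v : V) : Prop :=
  ∃ p : G.Walk u v, ∀ x ∈ p.support, x = u ∨ x = v ∨ x ∈ X

/-- The vertices of `A` and the connecting sets `I i`, for `i ∈ J`, form an induced model of the
graph on `A` with edges `a i, b i`. -/
structure InducedModel (G : SimpleGraph V) (A : Set V) (J : Set ι) (a b : ι → V)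
    (I : ι → Set V) : Prop where
  left_mem : ∀ i ∈ J, a i ∈ A
  right_mem : ∀ i ∈ J, b i ∈ A
  ne : ∀ i ∈ J, a i ≠ b i
  inj : ∀ i ∈ J, ∀ j ∈ J, s(a i, b i) = s(a j, b j) → i = j
  indep : ∀ x ∈ A, ∀ y ∈ A, ¬ G.Adj x y
  notMem : ∀ i ∈ J, ∀ x ∈ I i, x ∉ A
  disj : ∀ i ∈ J, ∀ j ∈ J, i ≠ j → ∀ x ∈ I i, x ∉ I j
  anti : ∀ i ∈ J, ∀ j ∈ J, i ≠ j → ∀ x ∈ I i, ∀ y ∈ I j, ¬ G.Adj x y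
  attach : ∀ i ∈ J, ∀ x ∈ I i, ∀ w ∈ A, G.Adj w x → w = a i ∨ w = b i
  link : ∀ i ∈ J, Linked G (I i) (a i) (b i)

/-- Few of the pairs are edges of `G` when out-degrees are bounded. -/
lemma card_adjacent_pairs_le [Fintype ι] {d : ℕ} {G : SimpleGraph V} {A : Finset V} {a b : ι → V}
    {out : V → Finset V} (hd : ∀ v, (out v).card ≤ d)
    (hout : ∀ x ∈ A, ∀ y ∈ A, G.Adj x y → y ∈ out x ∨ x ∈ out y)
    (ha : ∀ i, a i ∈ A) (hb : ∀ i, b i ∈ A)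
    (hinj : ∀ i j, s(a i, b i) = s(a j, b j) → i = j) :
    (Finset.univ.filter (fun i => G.Adj (a i) (b i))).card ≤ d * A.card := by
  have h1 : (A.sigma (fun x => out x)).card ≤ d * A.card := by
    rw [Finset.card_sigma, mul_comm, ← smul_eq_mul]
    exact Finset.sum_le_card_nsmul _ _ _ (fun x _ => hd x)
  refine le_trans (Finset.card_le_card_of_injOn
    (fun i => if b i ∈ out (a i) then (⟨a i, b i⟩ : Σ _ : V, V) else ⟨b i, a i⟩) ?_ ?_) h1
  · intro i hi
    have hi : G.Adj (a i) (b i) := by simpa using hi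
    have := hout _ (ha i) _ (hb i) hi
    simp only [Finset.coe_sigma, Set.mem_sigma_iff, Finset.mem_coe]
    split_ifs with h
    · exact ⟨ha i, h⟩
    · exact ⟨hb i, by tauto⟩
  · intro i _ j _ hij
    apply hinj
    simp only at hij
    rw [Sym2.eq_iff]
    split_ifs at hij <;> simp only [Sigma.mk.injEq, heq_eq_eq] at hij <;> tauto

lemma exists_sample {X : Type} [Fintype X] {D' B : ℕ} (hB : 0 < B) (J : Finset ι)
    (P bad : ι → Finset X) (A : Finset X) (hP : ∀ i, (P i).card = 3)
    (hbad : ∀ i, (bad i).card ≤ B) (hdisj : ∀ i, Disjoint (P i) (bad i))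
    (hbig : 2 * D' * (2 * B) ^ 2 * A.card < J.card) :
    ∃ (S A₀ : Finset X) (J₀ : Finset ι), (∀ x ∈ A, x ∈ S → x ∈ A₀) ∧
      (∀ i ∈ J₀, i ∈ J ∧ (∀ x ∈ P i, x ∈ S) ∧ ∀ x ∈ bad i, x ∉ S) ∧
      D' * A₀.card < J₀.card := by
  obtain ⟨N, hN⟩ : ∃ N, N = 2 * B := ⟨_, rfl⟩
  rw [← hN] at hbig
  have : NeZero N := ⟨by omega⟩
  have hNpos : (0 : ℝ) < N := by exact_mod_cast (show 0 < N by omega)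
  have h0 : 0 < Finset.expect Finset.univ (fun f : X → Fin N =>
      (∑ i ∈ J, if (∀ x ∈ P i, f x = 0) ∧ ∀ x ∈ bad i, f x ≠ 0 then (1 : ℝ) else 0) -
        D' * ∑ x ∈ A, if ∀ y ∈ ({x} : Finset X), f y = 0 then (1 : ℝ) else 0) := by
    rw [Finset.expect_sub_distrib, ← Finset.mul_expect, Finset.expect_sum_comm,
      Finset.expect_sum_comm]
    have e2 : ∀ i ∈ J, (1 / (N : ℝ)) ^ 3 * (1 / 2) ≤
        Finset.expect Finset.univ (fun f : X → Fin N =>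
          if (∀ x ∈ P i, f x = 0) ∧ ∀ x ∈ bad i, f x ≠ 0 then (1 : ℝ) else 0) := by
      intro i _
      refine le_trans ?_ (expect_good_ge (P i) (bad i) (hdisj i))
      rw [hP]
      apply mul_le_mul_of_nonneg_left _ (by positivity)
      have : ((bad i).card : ℝ) ≤ N / 2 := by
        rw [hN]; push_cast
        have : ((bad i).card : ℝ) ≤ B := by exact_mod_cast hbad i
        linarith
      have : ((bad i).card : ℝ) / N ≤ 1 / 2 := by
        rw [div_le_iff₀ hNpos]; linarith
      linarith
    have e3 := Finset.card_nsmul_le_sum _ _ _ e2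
    simp only [expect_forall_zero, Finset.card_singleton, Finset.sum_const, nsmul_eq_mul] at e3 ⊢
    refine sub_pos.2 (lt_of_lt_of_le ?_ e3)
    have e4 : (2 * D' * N ^ 2 * A.card : ℝ) < J.card := by exact_mod_cast hbig
    rw [pow_one, div_pow, one_pow]
    have : (D' * (A.card * (1 / N)) : ℝ) = (2 * D' * N ^ 2 * A.card) * (1 / N ^ 3 * (1 / 2)) := by
      field_simp
    rw [this]
    exact mul_lt_mul_of_pos_right e4 (by positivity)
  obtain ⟨f, hf⟩ := exists_pos_of_expect_pos _ h0
  simp only [Finset.sum_boole, Finset.mem_singleton, forall_eq] at hf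
  refine ⟨Finset.univ.filter (fun x => f x = 0), A.filter (fun x => f x = 0),
    J.filter (fun i => (∀ x ∈ P i, f x = 0) ∧ ∀ x ∈ bad i, f x ≠ 0), ?_, ?_, ?_⟩
  · intro x hx hxS
    simp only [Finset.mem_filter, Finset.mem_univ, true_and] at hxS ⊢
    exact ⟨hx, hxS⟩
  · intro i hi
    simpa only [Finset.mem_filter, Finset.mem_univ, true_and] using hi
  · exact_mod_cast sub_pos.1 hf

lemma exists_inducedModel_of_dense (d q m D' : ℕ) : ∃ D : ℕ, ∀ {V ι : Type} [Fintype V]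
    [Fintype ι] (G : SimpleGraph V) (A : Finset V) (a b : ι → V) (I : ι → Finset V)
    (out : V → Finset V), (∀ v, (out v).card ≤ d) →
    (∀ x y, (x ∈ A ∨ ∃ i, x ∈ I i) → (y ∈ A ∨ ∃ i, y ∈ I i) → G.Adj x y →
      y ∈ out x ∨ x ∈ out y) →
    (∀ i, a i ∈ A) → (∀ i, b i ∈ A) → (∀ i, a i ≠ b i) →
    (∀ i j, s(a i, b i) = s(a j, b j) → i = j) →
    (∀ i, (I i).card ≤ q) → (∀ i, ∀ x ∈ I i, x ∉ A) →
    (∀ x, (Finset.univ.filter (fun i => x ∈ I i)).card ≤ m) →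
    (∀ i, Linked G (I i) (a i) (b i)) → D * A.card < Fintype.card ι →
    ∃ (A' : Finset V) (J : Finset ι), InducedModel G (A' : Set V) (J : Set ι) a b (fun i => I i) ∧
      D' * A'.card < J.card := by
  obtain ⟨B, hB⟩ : ∃ B, B = (q + 2) * (d + 1) * (m + 1) := ⟨_, rfl⟩
  have hBpos : 0 < B := by rw [hB]; positivity
  refine ⟨2 * D' * (2 * B) ^ 2 + d, ?_⟩
  intro V ι _ _ G A a b I out hd hout ha hb hab hinj hq hIA hm hlink hdense
  have hcardadj := card_adjacent_pairs_le (G := G) hd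
    (fun x hx y hy => hout x y (Or.inl hx) (Or.inl hy)) ha hb hinj
  have hsplit := Finset.card_filter_add_card_filter_not (s := (Finset.univ : Finset ι))
        (fun i => G.Adj (a i) (b i))
  rw [Finset.card_univ] at hsplit
  set ι₀ := Finset.univ.filter (fun i => ¬ G.Adj (a i) (b i)) with hι₀
  have hbig : 2 * D' * (2 * B) ^ 2 * A.card < ι₀.card := by nlinarith
  -- the closed out-neighbourhoods of the connecting sets
  let Z : ι → Finset V := fun i => insert (a i) (insert (b i) (I i))
  let Y : ι → Finset V := fun i => Z i ∪ (Z i).biUnion out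
  have hZ : ∀ i, (Z i).card ≤ q + 2 := fun i =>
    (Finset.card_insert_le _ _).trans (by
      have := Finset.card_insert_le (b i) (I i)
      have := hq i
      omega)
  have hY : ∀ i, (Y i).card ≤ (q + 2) * (d + 1) := by
    intro i
    have h1 : ((Z i).biUnion out).card ≤ (Z i).card * d :=
      Finset.card_biUnion_le_card_mul _ _ _ (fun x _ => hd x)
    have h2 := Finset.card_union_le (Z i) ((Z i).biUnion out)
    have h3 := hZ i
    calc (Y i).card ≤ (Z i).card + (Z i).card * d := by simp only [Y]; omega
      _ = (Z i).card * (d + 1) := by ring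
      _ ≤ _ := Nat.mul_le_mul_right _ h3
  let P : ι → Finset (V ⊕ ι) := fun i => {Sum.inl (a i), Sum.inl (b i), Sum.inr i}
  let bad : ι → Finset (V ⊕ ι) := fun i =>
    ((Y i).filter (fun y => y ≠ a i ∧ y ≠ b i)).disjSum
      (Finset.univ.filter (fun j => j ≠ i ∧ ∃ y ∈ I j, y ∈ I i ∨ (∃ x ∈ I i, y ∈ out x) ∨
        ∃ x, (x = a i ∨ x = b i) ∧ ¬ (x = a j ∨ x = b j) ∧ y ∈ out x))
  have hP : ∀ i, (P i).card = 3 := by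
    intro i
    simp only [P]
    rw [Finset.card_insert_of_notMem (by simp [hab i]), Finset.card_pair (by simp)]
  have hbad : ∀ i, (bad i).card ≤ B := by
    intro i
    simp only [bad]
    rw [Finset.card_disjSum]
    have h1 : ((Y i).filter (fun y => y ≠ a i ∧ y ≠ b i)).card ≤ (Y i).card :=
      Finset.card_filter_le _ _
    have h2 : (Finset.univ.filter (fun j => j ≠ i ∧ ∃ y ∈ I j, y ∈ I i ∨ (∃ x ∈ I i, y ∈ out x) ∨
        ∃ x, (x = a i ∨ x = b i) ∧ ¬ (x = a j ∨ x = b j) ∧ y ∈ out x)).card ≤ (Y i).card * m := by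
      refine le_trans (Finset.card_le_card ?_) (Finset.card_biUnion_le_card_mul (Y i)
        (fun y => Finset.univ.filter (fun j => y ∈ I j)) m (fun y _ => hm y))
      intro j hj
      rw [Finset.mem_filter] at hj
      obtain ⟨-, -, y, hyj, hy⟩ := hj
      rw [Finset.mem_biUnion]
      refine ⟨y, ?_, by simpa using hyj⟩
      simp only [Y, Z, Finset.mem_union, Finset.mem_biUnion, Finset.mem_insert]
      rcases hy with hy | ⟨x, hx, hy⟩ | ⟨x, hx, -, hy⟩
      · exact Or.inl (Or.inr (Or.inr hy))
      · exact Or.inr ⟨x, Or.inr (Or.inr hx), hy⟩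
      · exact Or.inr ⟨x, by tauto, hy⟩
    calc _ ≤ (Y i).card + (Y i).card * m := add_le_add h1 h2
      _ = (Y i).card * (m + 1) := by ring
      _ ≤ (q + 2) * (d + 1) * (m + 1) := Nat.mul_le_mul_right _ (hY i)
      _ = B := hB.symm
  have hdisj : ∀ i, Disjoint (P i) (bad i) := by
    intro i
    rw [Finset.disjoint_left]
    intro x hx hx'
    simp only [P, Finset.mem_insert, Finset.mem_singleton] at hx
    rcases hx with rfl | rfl | rfl <;> simp [bad] at hx'
  obtain ⟨S, A₀, J, hA₀, hJ₀, hS⟩ := exists_sample (D' := D') hBpos ι₀ P bad (A.map Function.Embedding.inl) hP hbad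
    hdisj (by rw [Finset.card_map]; exact hbig)
  have hJ : ∀ i ∈ J, ¬ G.Adj (a i) (b i) ∧ (∀ x ∈ P i, x ∈ S) ∧ ∀ x ∈ bad i, x ∉ S := by
    intro i hi
    have h := hJ₀ i hi
    rw [hι₀, Finset.mem_filter] at h
    exact ⟨h.1.2, h.2⟩
  have hJa : ∀ i ∈ J, Sum.inl (a i) ∈ S := fun i hi => (hJ i hi).2.1 _ (by simp [P])
  have hJb : ∀ i ∈ J, Sum.inl (b i) ∈ S := fun i hi => (hJ i hi).2.1 _ (by simp [P])
  have hJi : ∀ i ∈ J, Sum.inr i ∈ S := fun i hi => (hJ i hi).2.1 _ (by simp [P])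
  let A' : Finset V := A.filter (fun x => ∃ i ∈ J, x = a i ∨ x = b i)
  have hA' : ∀ x ∈ A', x ∈ A ∧ ∃ i ∈ J, x = a i ∨ x = b i := by
    intro x hx; simpa [A'] using hx
  have hA'0 : ∀ x ∈ A', Sum.inl x ∈ S := by
    intro x hx
    obtain ⟨-, i, hi, rfl | rfl⟩ := hA' x hx
    · exact hJa i hi
    · exact hJb i hi
  -- out-neighbours of kept objects that are kept
  have hYA : ∀ i ∈ J, ∀ y ∈ Y i, y ∈ A' → y = a i ∨ y = b i := by
    intro i hi y hy hyA
    by_contra hne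
    push Not at hne
    refine (hJ i hi).2.2 (Sum.inl y) ?_ (hA'0 y hyA)
    simp only [bad, Finset.inl_mem_disjSum, Finset.mem_filter]
    exact ⟨hy, hne⟩
  have houtY : ∀ i, ∀ x, (x = a i ∨ x = b i ∨ x ∈ I i) → ∀ y ∈ out x, y ∈ Y i := by
    intro i x hx y hy
    simp only [Y, Z, Finset.mem_union, Finset.mem_biUnion, Finset.mem_insert]
    exact Or.inr ⟨x, hx, hy⟩
  have hindep : ∀ x ∈ A', ∀ y ∈ A', G.Adj x y → y ∉ out x := by
    intro x hx y hy hxy hyx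
    obtain ⟨-, i, hi, hxi⟩ := hA' x hx
    have := hYA i hi y (houtY i x (by tauto) y hyx) hy
    have hn := (hJ i hi).1
    rcases hxi with rfl | rfl <;> rcases this with rfl | rfl
    · exact hxy.ne rfl
    · exact hn hxy
    · exact hn hxy.symm
    · exact hxy.ne rfl
  have hanti : ∀ i ∈ J, ∀ j ∈ J, i ≠ j → ∀ x ∈ I i, ∀ y ∈ I j, y ∉ out x := by
    intro i hi j hj hij x hx y hy hyx
    refine (hJ i hi).2.2 (Sum.inr j) ?_ (hJi j hj)
    simp only [bad, Finset.inr_mem_disjSum, Finset.mem_filter, Finset.mem_univ, true_and]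
    exact ⟨hij.symm, y, hy, Or.inr (Or.inl ⟨x, hx, hyx⟩)⟩
  refine ⟨A', J, ⟨?_, ?_, fun i _ => hab i, fun i _ j _ => hinj i j, ?_, ?_, ?_, ?_, ?_,
    fun i _ => hlink i⟩, ?_⟩
  · intro i hi
    simp only [A', Finset.coe_filter, Set.mem_ofPred_eq]
    exact ⟨ha i, i, hi, Or.inl rfl⟩
  · intro i hi
    simp only [A', Finset.coe_filter, Set.mem_ofPred_eq]
    exact ⟨hb i, i, hi, Or.inr rfl⟩
  · intro x hx y hy hxy
    rcases hout x y (Or.inl (hA' x hx).1) (Or.inl (hA' y hy).1) hxy with h | h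
    · exact hindep x hx y hy hxy h
    · exact hindep y hy x hx hxy.symm h
  · intro i _ x hx hxA
    exact hIA i x hx (hA' x hxA).1
  · intro i hi j hj hij x hx hx'
    refine (hJ i hi).2.2 (Sum.inr j) ?_ (hJi j hj)
    simp only [bad, Finset.inr_mem_disjSum, Finset.mem_filter, Finset.mem_univ, true_and]
    exact ⟨hij.symm, x, hx', Or.inl hx⟩
  · intro i hi j hj hij x hx y hy hxy
    rcases hout x y (Or.inr ⟨i, hx⟩) (Or.inr ⟨j, hy⟩) hxy with h | h
    · exact hanti i hi j hj hij x hx y hy h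
    · exact hanti j hj i hi hij.symm y hy x hx h
  · intro i hi x hx w hw hwx
    rcases hout w x (Or.inl (hA' w hw).1) (Or.inr ⟨i, hx⟩) hwx with h | h
    · obtain ⟨-, j, hj, hwj⟩ := hA' w hw
      by_contra hne
      have hij : i ≠ j := by
        rintro rfl
        exact hne hwj
      refine (hJ j hj).2.2 (Sum.inr i) ?_ (hJi i hi)
      simp only [bad, Finset.inr_mem_disjSum, Finset.mem_filter, Finset.mem_univ, true_and]
      exact ⟨hij, x, hx, Or.inr (Or.inr ⟨w, hwj, hne, h⟩)⟩
    · exact hYA i hi w (houtY i x (by tauto) w h) hw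
  · refine lt_of_le_of_lt (Nat.mul_le_mul_left _ ?_) hS
    rw [← Finset.card_map Function.Embedding.inl]
    apply Finset.card_le_card
    intro x hx
    rw [Finset.mem_map] at hx
    obtain ⟨y, hy, rfl⟩ := hx
    exact hA₀ _ (Finset.mem_map_of_mem _ (hA' y hy).1) (hA'0 y hy)

end InducedModels

/-! ## Topological models in dense graphs -/

section TopologicalModels

lemma Linked.mono {V : Type} {G : SimpleGraph V} {X Y : Set V} {u v : V} (h : Linked G X u v)
    (hXY : ∀ x ∈ X, x = u ∨ x = v ∨ x ∈ Y) : Linked G Y u v := by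
  obtain ⟨p, hp⟩ := h
  refine ⟨p, fun x hx => ?_⟩
  have := hp x hx
  have := hXY x
  tauto

lemma Linked.symm {V : Type} {G : SimpleGraph V} {X : Set V} {u v : V} (h : Linked G X u v) :
    Linked G X v u := by
  obtain ⟨p, hp⟩ := h
  refine ⟨p.reverse, fun x hx => ?_⟩
  have := hp x (by simpa using hx)
  tauto

lemma Linked.trans {V : Type} {G : SimpleGraph V} {X : Set V} {u v w : V} (h : Linked G X u v)
    (h' : Linked G X v w) (hv : v ∈ X) : Linked G X u w := by
  obtain ⟨p, hp⟩ := h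
  obtain ⟨q, hq⟩ := h'
  refine ⟨p.append q, fun x hx => ?_⟩
  rw [Walk.mem_support_append_iff] at hx
  rcases hx with hx | hx
  · rcases hp x hx with h | rfl | h
    · exact Or.inl h
    · exact Or.inr (Or.inr hv)
    · exact Or.inr (Or.inr h)
  · rcases hq x hx with rfl | h | h
    · exact Or.inr (Or.inr hv)
    · exact Or.inr (Or.inl h)
    · exact Or.inr (Or.inr h)

lemma Linked.of_adj {V : Type} {G : SimpleGraph V} {X : Set V} {u v : V} (h : G.Adj u v) :
    Linked G X u v :=
  ⟨h.toWalk, fun x hx => by simp at hx; tauto⟩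

lemma Linked.refl {V : Type} (G : SimpleGraph V) (X : Set V) (u : V) : Linked G X u u :=
  ⟨Walk.nil, fun x hx => by simp at hx; tauto⟩

/-- A dense graph contains a connected set whose neighbourhood induces a dense graph. -/
lemma exists_connected_dense_nbrs {V : Type} {K : SimpleGraph V} {c : ℕ} (hc : 1 ≤ c)
    {W : Finset V} (hW : W.Nonempty) (hK : 2 * c * W.card ≤ degSum K W) :
    ∃ U N : Finset V, U ⊆ W ∧ N ⊆ W ∧ Disjoint U N ∧ N.Nonempty ∧ c * N.card ≤ degSum K N ∧
      (∀ x ∈ U, ∀ y ∈ U, Linked K U x y) ∧ ∀ w ∈ N, ∃ u ∈ U, K.Adj u w := by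
  let bd : Finset V → Finset V → Finset V := fun U W' => W'.filter (fun w => ∃ u ∈ U, K.Adj u w)
  let good : Finset V → Finset V → Prop := fun U W' => U ⊆ W ∧ W' ⊆ W ∧ Disjoint U W' ∧
    (∀ x ∈ U, ∀ y ∈ U, Linked K U x y) ∧
    2 * c * (W'.card + 1) ≤ degSum K W' + 2 * (bd U W').card
  have hstart : ∀ W' ⊆ W, ∀ v ∈ W', 2 * c * W'.card ≤ degSum K W' → good {v} (W'.erase v) := by
    intro W' hW' v hv hd
    refine ⟨by simpa using hW' hv, (Finset.erase_subset _ _).trans hW', by simp, ?_, ?_⟩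
    · intro x hx y hy
      rw [Finset.mem_singleton] at hx hy
      subst hx; subst hy
      exact Linked.refl _ _ _
    · rw [Finset.card_erase_add_one hv]
      rw [degSum_erase K hv] at hd
      have : nbrIn K W' v ⊆ bd {v} (W'.erase v) := by
        intro x hx
        rw [mem_nbrIn] at hx
        simp only [bd, Finset.mem_filter, Finset.mem_erase, Finset.mem_singleton, exists_eq_left]
        exact ⟨⟨hx.2.ne', hx.1⟩, hx.2⟩
      have := Finset.card_le_card this
      omega
  have hex : ∃ n, ∃ U W', W'.card = n ∧ good U W' := by
    obtain ⟨v, hv⟩ := hW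
    exact ⟨_, {v}, W.erase v, rfl, hstart W subset_rfl v hv hK⟩
  obtain ⟨U, W', hn, hU, hW', hdis, hconn, hpot⟩ := Nat.find_spec hex
  have hmin : ∀ U₁ W₁, W₁.card < W'.card → ¬ good U₁ W₁ := by
    intro U₁ W₁ hlt hg
    rw [hn] at hlt
    exact Nat.find_min hex hlt ⟨U₁, W₁, rfl, hg⟩
  have hN : (bd U W').Nonempty := by
    by_contra hne
    rw [Finset.not_nonempty_iff_eq_empty] at hne
    rw [hne, Finset.card_empty] at hpot
    have hne' : W'.Nonempty := by
      by_contra h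
      rw [Finset.not_nonempty_iff_eq_empty] at h
      subst h
      simp [degSum] at hpot
      omega
    obtain ⟨v, hv⟩ := hne'
    refine hmin _ _ ?_ (hstart W' hW' v hv (by nlinarith))
    rw [← Finset.card_erase_add_one hv]
    omega
  refine ⟨U, bd U W', hU, (Finset.filter_subset _ _).trans hW',
    Finset.disjoint_of_subset_right (Finset.filter_subset _ _) hdis, hN, ?_, hconn, ?_⟩
  · unfold degSum
    rw [mul_comm, ← smul_eq_mul]
    refine Finset.card_nsmul_le_sum _ _ _ (fun w hw => ?_)
    have hw' := hw
    simp only [bd, Finset.mem_filter] at hw'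
    obtain ⟨hwW, u, hu, huw⟩ := hw'
    have h1 := hmin (insert w U) (W'.erase w) (by
      rw [← Finset.card_erase_add_one hwW]
      omega)
    have h2 : ¬ 2 * c * ((W'.erase w).card + 1) ≤
        degSum K (W'.erase w) + 2 * (bd (insert w U) (W'.erase w)).card := by
      intro hcon
      refine h1 ⟨?_, (Finset.erase_subset _ _).trans hW', ?_, ?_, hcon⟩
      · exact Finset.insert_subset (hW' hwW) hU
      · rw [Finset.disjoint_insert_left]
        exact ⟨by simp, Finset.disjoint_of_subset_right (Finset.erase_subset _ _) hdis⟩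
      · have hu' : ∀ x ∈ U, Linked K ((insert w U : Finset V) : Set V) x w := by
          intro x hx
          refine Linked.trans (v := u) ?_ (Linked.of_adj huw) (by simp [hu])
          exact (hconn x hx u hu).mono (fun z hz => by
            right; right
            simp only [Finset.coe_insert]
            exact Or.inr hz)
        intro x hx y hy
        rw [Finset.mem_insert] at hx hy
        rcases hx with rfl | hx <;> rcases hy with rfl | hy
        · exact Linked.refl _ _ _
        · exact (hu' y hy).symm
        · exact hu' x hx
        · exact (hu' x hx).trans (hu' y hy).symm (by simp)
    rw [Finset.card_erase_add_one hwW] at h2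
    have h3 := degSum_erase K hwW
    have h4 : (bd U W').card + (nbrIn K W' w).card ≤
        (bd (insert w U) (W'.erase w)).card + 1 + (nbrIn K (bd U W') w).card := by
      have e1 : bd U W' ∩ nbrIn K W' w ⊆ nbrIn K (bd U W') w := by
        intro x hx
        rw [Finset.mem_inter, mem_nbrIn] at hx
        rw [mem_nbrIn]
        exact ⟨hx.1, hx.2.2⟩
      have e2 : bd U W' ∪ nbrIn K W' w ⊆ insert w (bd (insert w U) (W'.erase w)) := by
        intro x hx
        simp only [Finset.mem_union, mem_nbrIn, bd, Finset.mem_filter, Finset.mem_insert,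
          Finset.mem_erase] at hx ⊢
        by_cases hxw : x = w
        · exact Or.inl hxw
        · right
          rcases hx with ⟨hx, z, hz, hzx⟩ | ⟨hx, hwx⟩
          · exact ⟨⟨hxw, hx⟩, z, Or.inr hz, hzx⟩
          · exact ⟨⟨hxw, hx⟩, w, Or.inl rfl, hwx⟩
      have f1 := Finset.card_le_card e1
      have f2 := (Finset.card_le_card e2).trans (Finset.card_insert_le _ _)
      have f3 := Finset.card_union_add_card_inter (bd U W') (nbrIn K W' w)
      omega
    have h5 : 2 * c * (W'.card + 1) = 2 * c * W'.card + 2 * c := by ring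
    omega
  · intro w hw
    simp only [bd, Finset.mem_filter] at hw
    exact hw.2

/-- Sufficiently dense graphs contain a topological model of any prescribed graph. -/
lemma exists_topological_model {h : ℕ} (E : Finset (Fin h × Fin h)) :
    ∃ c : ℕ, 1 ≤ c ∧ ∀ {V : Type} (K : SimpleGraph V) (W : Finset V), W.Nonempty →
      c * W.card ≤ degSum K W → ∃ (φ : Fin h → V) (C : Fin h × Fin h → Set V),
        Function.Injective φ ∧ (∀ u, φ u ∈ W) ∧
        ∀ e ∈ E, (∀ x ∈ C e, x ∈ W) ∧ (∀ u, φ u ∉ C e) ∧ Linked K (C e) (φ e.1) (φ e.2) ∧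
          ∀ e' ∈ E, e ≠ e' → ∀ x ∈ C e, x ∉ C e' := by
  induction E using Finset.induction_on with
  | empty =>
    refine ⟨h + 1, by omega, fun {V} K W hW hK => ?_⟩
    have h1 : degSum K W ≤ W.card * W.card := by
      unfold degSum
      rw [← smul_eq_mul]
      exact Finset.sum_le_card_nsmul _ _ _ (fun v _ => Finset.card_filter_le _ _)
    have h2 : h ≤ W.card := by
      have := Nat.le_of_mul_le_mul_right (hK.trans h1) hW.card_pos
      omega
    have h3 : Fintype.card (Fin h) ≤ Fintype.card W := by simpa using h2
    obtain ⟨φ⟩ := Function.Embedding.nonempty_of_card_le h3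
    exact ⟨fun u => φ u, fun _ => ∅, fun u v huv => φ.injective (Subtype.ext huv),
      fun u => (φ u).2, by simp⟩
  | insert e E he ih =>
    obtain ⟨c, hc, ih⟩ := ih
    refine ⟨2 * c, by omega, fun {V} K W hW hK => ?_⟩
    obtain ⟨U, N, hU, hN, hUN, hne, hd, hconn, hnb⟩ := exists_connected_dense_nbrs hc hW hK
    obtain ⟨φ, C, hφ, hφN, hC⟩ := ih K N hne hd
    have hUN' : ∀ x ∈ U, x ∉ N := fun x hx hx' => Finset.disjoint_left.1 hUN hx hx'
    refine ⟨φ, fun e' => if e' = e then U else C e', hφ, fun u => hN (hφN u), ?_⟩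
    intro e₁ he₁
    rw [Finset.mem_insert] at he₁
    rcases he₁ with rfl | he₁
    · simp only [if_true]
      refine ⟨fun x hx => hU hx, fun u hu => hUN' _ hu (hφN u), ?_, ?_⟩
      · obtain ⟨x, hx, hx'⟩ := hnb _ (hφN e₁.1)
        obtain ⟨y, hy, hy'⟩ := hnb _ (hφN e₁.2)
        exact ((Linked.of_adj hx'.symm).trans (hconn x hx y hy) hx).trans (Linked.of_adj hy') hy
      · intro e' he' hne' x hx
        rw [Finset.mem_insert] at he'
        have h1 : e' ≠ e₁ := hne'.symm
        have h2 : e' ∈ E := by tauto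
        rw [if_neg h1]
        exact fun hx' => hUN' x hx ((hC e' h2).1 x hx')
    · have h1 : e₁ ≠ e := fun h => he (h ▸ he₁)
      obtain ⟨g1, g2, g3, g4⟩ := hC e₁ he₁
      beta_reduce
      rw [if_neg h1]
      refine ⟨fun x hx => hN (g1 x hx), g2, g3, ?_⟩
      intro e' he' hne' x hx
      rw [Finset.mem_insert] at he'
      split_ifs with h2
      · exact fun hx' => hUN' x hx' (g1 x hx)
      · exact g4 e' (by tauto) hne' x hx

end TopologicalModels

/-! ## Composition of models and induced subdivisions -/

section Composition

lemma Linked.of_walk {V : Type} {G K : SimpleGraph V} {T Y : Set V} (hTY : T ⊆ Y)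
    (hK : ∀ x ∈ T, ∀ y ∈ T, K.Adj x y → Linked G Y x y) {u v : V} (p : K.Walk u v)
    (hp : ∀ x ∈ p.support, x ∈ T) : Linked G Y u v := by
  induction p with
  | nil => exact Linked.refl _ _ _
  | cons h p ih =>
    have hy := hp _ (List.mem_cons_of_mem _ p.start_mem_support)
    exact (hK _ (hp _ (by simp)) _ hy h).trans
      (ih fun x hx => hp x (List.mem_cons_of_mem _ hx)) (hTY hy)

/-- A topological model inside the graph encoded by an induced model is again an induced model. -/
lemma InducedModel.comp {V ι : Type} {G : SimpleGraph V} {A : Set V} {J : Set ι} {a b : ι → V}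
    {I : ι → Set V} (M : InducedModel G A J a b I) {K : SimpleGraph V}
    (hK : ∀ x y, K.Adj x y → ∃ i ∈ J, s(a i, b i) = s(x, y)) {h : ℕ}
    {E : Finset (Fin h × Fin h)} (hE : ∀ e ∈ E, e.1 < e.2) {φ : Fin h → V}
    {C : Fin h × Fin h → Set V} (hφ : Function.Injective φ) (hφA : ∀ u, φ u ∈ A)
    (hC : ∀ e ∈ E, (∀ x ∈ C e, x ∈ A) ∧ (∀ u, φ u ∉ C e) ∧ Linked K (C e) (φ e.1) (φ e.2) ∧
      ∀ e' ∈ E, e ≠ e' → ∀ x ∈ C e, x ∉ C e') :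
    ∃ X : Fin h × Fin h → Set V,
      InducedModel G (Set.range φ) (E : Set (Fin h × Fin h)) (fun e => φ e.1) (fun e => φ e.2)
        X := by
  let T : Fin h × Fin h → Set V := fun e => {x | x = φ e.1 ∨ x = φ e.2 ∨ x ∈ C e}
  have hTT : ∀ e ∈ E, ∀ e' ∈ E, e ≠ e' → ∀ x, x ∈ T e → x ∈ T e' → x ∉ C e ∧ x ∉ C e' := by
    intro e he e' he' hne x hx hx'
    simp only [T, Set.mem_ofPred_eq] at hx hx'
    have h1 := (hC e he).2.1
    have h2 := (hC e' he').2.1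
    have h3 := (hC e he).2.2.2 e' he' hne x
    constructor
    · intro hxe
      rcases hx' with rfl | rfl | hx'
      · exact h1 _ hxe
      · exact h1 _ hxe
      · exact h3 hxe hx'
    · intro hxe
      rcases hx with rfl | rfl | hx
      · exact h2 _ hxe
      · exact h2 _ hxe
      · exact h3 hx hxe
  have hsep : ∀ e ∈ E, ∀ e' ∈ E, ∀ i ∈ J, a i ∈ T e → b i ∈ T e → a i ∈ T e' → b i ∈ T e' →
      e = e' := by
    intro e he e' he' i hi h1 h2 h3 h4
    by_contra hne
    obtain ⟨n1, n2⟩ := hTT e he e' he' hne _ h1 h3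
    obtain ⟨n3, n4⟩ := hTT e he e' he' hne _ h2 h4
    simp only [T, Set.mem_ofPred_eq, n1, n2, n3, n4, or_false] at h1 h2 h3 h4
    have hab := M.ne i hi
    have l1 := hE e he
    have l2 := hE e' he'
    have : e.1 = e'.1 ∧ e.2 = e'.2 := by
      rcases h1 with h1 | h1 <;> rcases h2 with h2 | h2 <;> rcases h3 with h3 | h3 <;>
        rcases h4 with h4 | h4 <;> first
        | exact absurd (h1.trans h2.symm) hab
        | exact absurd (h3.trans h4.symm) hab
        | (have q1 := hφ (h1.symm.trans h3)
           have q2 := hφ (h2.symm.trans h4)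
           constructor <;> omega)
    exact hne (Prod.ext this.1 this.2)
  refine ⟨fun e => {x | x ∈ C e ∨ ∃ i ∈ J, a i ∈ T e ∧ b i ∈ T e ∧ x ∈ I i},
    ⟨fun e _ => ⟨_, rfl⟩, fun e _ => ⟨_, rfl⟩, ?_, ?_, ?_, ?_, ?_, ?_, ?_, ?_⟩⟩
  · intro e he heq
    have := hE e he
    exact this.ne (hφ heq)
  · intro e he e' he' heq
    have l1 := hE e he
    have l2 := hE e' he'
    rw [Sym2.eq_iff] at heq
    rcases heq with ⟨q1, q2⟩ | ⟨q1, q2⟩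
    · exact Prod.ext (hφ q1) (hφ q2)
    · have := hφ q1
      have := hφ q2
      omega
  · rintro _ ⟨u, rfl⟩ _ ⟨v, rfl⟩
    exact M.indep _ (hφA u) _ (hφA v)
  · rintro e he x (hx | ⟨i, hi, -, -, hx⟩) ⟨u, rfl⟩
    · exact (hC e he).2.1 u hx
    · exact M.notMem i hi _ hx (hφA u)
  · rintro e he e' he' hne x (hx | ⟨i, hi, h1, h2, hx⟩) (hx' | ⟨j, hj, h3, h4, hx'⟩)
    · exact (hC e he).2.2.2 e' he' hne x hx hx'
    · exact M.notMem j hj x hx' ((hC e he).1 x hx)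
    · exact M.notMem i hi x hx ((hC e' he').1 x hx')
    · by_cases hij : i = j
      · subst hij
        exact hne (hsep e he e' he' i hi h1 h2 h3 h4)
      · exact M.disj i hi j hj hij x hx hx'
  · have key : ∀ e ∈ E, ∀ e' ∈ E, e ≠ e' → ∀ x ∈ C e, ∀ j ∈ J, a j ∈ T e' → b j ∈ T e' →
        ∀ y ∈ I j, ¬ G.Adj x y := by
      intro e he e' he' hne x hx j hj h3 h4 y hy hxy
      have hxT : x ∈ T e' := by
        rcases M.attach j hj y hy x ((hC e he).1 x hx) hxy with rfl | rfl
        · exact h3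
        · exact h4
      exact (hTT e he e' he' hne x (Or.inr (Or.inr hx)) hxT).1 hx
    rintro e he e' he' hne x (hx | ⟨i, hi, h1, h2, hx⟩) y (hy | ⟨j, hj, h3, h4, hy⟩) hxy
    · exact M.indep x ((hC e he).1 x hx) y ((hC e' he').1 y hy) hxy
    · exact key e he e' he' hne x hx j hj h3 h4 y hy hxy
    · exact key e' he' e he hne.symm y hy i hi h1 h2 x hx hxy.symm
    · by_cases hij : i = j
      · subst hij
        exact hne (hsep e he e' he' i hi h1 h2 h3 h4)
      · exact M.anti i hi j hj hij x hx y hy hxy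
  · rintro e he x (hx | ⟨i, hi, h1, h2, hx⟩) _ ⟨u, rfl⟩ hux
    · exact absurd hux (M.indep _ (hφA u) _ ((hC e he).1 x hx))
    · have huT : φ u ∈ T e := by
        rcases M.attach i hi x hx _ (hφA u) hux with h | h
        · rw [h]; exact h1
        · rw [h]; exact h2
      rcases huT with h | h | h
      · exact Or.inl h
      · exact Or.inr h
      · exact absurd h ((hC e he).2.1 u)
  · intro e he
    obtain ⟨p, hp⟩ := (hC e he).2.2.1
    have h1 : Linked G {x | x ∈ T e ∨ ∃ i ∈ J, a i ∈ T e ∧ b i ∈ T e ∧ x ∈ I i}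
        (φ e.1) (φ e.2) := by
      refine Linked.of_walk (T := T e) (fun x hx => Or.inl hx) ?_ p hp
      intro x hx y hy hxy
      obtain ⟨i, hi, hxi⟩ := hK x y hxy
      have hl := M.link i hi
      rw [Sym2.eq_iff] at hxi
      rcases hxi with ⟨rfl, rfl⟩ | ⟨rfl, rfl⟩
      · exact hl.mono (fun z hz => Or.inr (Or.inr (Or.inr ⟨i, hi, hx, hy, hz⟩)))
      · exact hl.symm.mono (fun z hz => Or.inr (Or.inr (Or.inr ⟨i, hi, hy, hx, hz⟩)))
    refine h1.mono ?_
    rintro x ((h | h | h) | h)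
    · exact Or.inl h
    · exact Or.inr (Or.inl h)
    · exact Or.inr (Or.inr (Or.inl h))
    · exact Or.inr (Or.inr (Or.inr h))

/-- Linked vertices are joined by an induced path. -/
lemma Linked.exists_induced_path {V : Type} {G : SimpleGraph V} {X : Set V} {u v : V}
    (h : Linked G X u v) : ∃ (L : ℕ) (g : ℕ → V), g 0 = u ∧ g L = v ∧
      (∀ i ≤ L, g i = u ∨ g i = v ∨ g i ∈ X) ∧ (∀ i ≤ L, ∀ j ≤ L, g i = g j → i = j) ∧
      ∀ i ≤ L, ∀ j ≤ L, (G.Adj (g i) (g j) ↔ i + 1 = j ∨ j + 1 = i) := by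
  obtain ⟨p, hp⟩ := h
  let S : Set V := {x | x = u ∨ x = v ∨ x ∈ X}
  let K := G.induce S
  have hr : K.Reachable ⟨u, Or.inl rfl⟩ ⟨v, Or.inr (Or.inl rfl)⟩ := (p.induce S hp).reachable
  obtain ⟨q, hq⟩ := hr.exists_walk_length_eq_dist
  have hd : ∀ i ≤ q.length, K.dist ⟨u, Or.inl rfl⟩ (q.getVert i) = i := by
    intro i hi
    have h1 := K.dist_le (q.take i)
    have h2 := K.dist_le ((q.take i).append (q.drop i))
    have h3 := K.dist_le (q.drop i)
    have h4 := (q.take i).reachable.dist_triangle_left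
      (w := ⟨v, Or.inr (Or.inl rfl)⟩)
    rw [Walk.take_length] at h1
    rw [Walk.drop_length] at h3
    omega
  have hadj : ∀ i ≤ q.length, ∀ j ≤ q.length, K.Adj (q.getVert i) (q.getVert j) → j ≤ i + 1 := by
    intro i hi j hj hij
    have h1 := hij.reachable.dist_triangle_right (u := (⟨u, Or.inl rfl⟩ : S))
    rw [hd i hi, hd j hj, dist_eq_one_iff_adj.2 hij] at h1
    exact h1
  refine ⟨q.length, fun i => (q.getVert i : S), by simp, by simp, fun i _ => (q.getVert i).2, ?_, ?_⟩
  · intro i hi j hj hij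
    have := congrArg (K.dist ⟨u, Or.inl rfl⟩) (Subtype.ext hij)
    rwa [hd i hi, hd j hj] at this
  · intro i hi j hj
    constructor
    · intro h
      have h1 := hadj i hi j hj h
      have h2 := hadj j hj i hi h.symm
      have h3 : i ≠ j := by
        rintro rfl
        exact h.ne rfl
      omega
    · rintro (rfl | rfl)
      · exact q.adj_getVert_succ (by omega)
      · exact (q.adj_getVert_succ (by omega)).symm

end Composition

section InducedSubdivisions

/-- An induced model of `H` contains an induced subdivision of `H`. -/
lemma InducedModel.exists_subdiv {V : Type} {G : SimpleGraph V} {n : ℕ} {H : SimpleGraph (Fin n)}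
    {φ : Fin n → V} (hφ : Function.Injective φ) {J : Set (Fin n × Fin n)}
    (hJ : ∀ e : Edges H, e.1 ∈ J) {X : Fin n × Fin n → Set V}
    (M : InducedModel G (Set.range φ) J (fun e => φ e.1) (fun e => φ e.2) X) :
    ∃ t : Edges H → ℕ, IsInducedSubgraphOf (Subdiv H t) G := by
  have hlink : ∀ e : Edges H, ∃ (L : ℕ) (g : ℕ → V), g 0 = φ e.1.1 ∧ g L = φ e.1.2 ∧
      (∀ i ≤ L, g i = φ e.1.1 ∨ g i = φ e.1.2 ∨ g i ∈ X e.1) ∧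
      (∀ i ≤ L, ∀ j ≤ L, g i = g j → i = j) ∧
      ∀ i ≤ L, ∀ j ≤ L, (G.Adj (g i) (g j) ↔ i + 1 = j ∨ j + 1 = i) :=
    fun e => (M.link e.1 (hJ e)).exists_induced_path
  choose L g g0 gL gX ginj gadj using hlink
  have hL : ∀ e, 2 ≤ L e := by
    intro e
    by_contra hlt
    have h01 : L e = 0 ∨ L e = 1 := by omega
    rcases h01 with h | h
    · have := gL e
      rw [h, g0 e] at this
      exact e.2.1.ne (hφ this)
    · have h1 := (gadj e 0 (by omega) 1 (by omega)).2 (Or.inl rfl)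
      have h2 := gL e
      rw [h] at h2
      rw [g0, h2] at h1
      exact M.indep _ ⟨_, rfl⟩ _ ⟨_, rfl⟩ h1
  have h_internal : ∀ e, ∀ i, i + 1 < L e → g e (i + 1) ∈ X e.1 := by
    intro e i hi
    rcases gX e (i + 1) (by omega) with h | h | h
    · rw [← g0] at h
      have := ginj e _ (by omega) _ (by omega) h
      omega
    · rw [← gL] at h
      have := ginj e _ (by omega) _ le_rfl h
      omega
    · exact h
  let F : (Fin n ⊕ Σ e : Edges H, Fin (L e - 1)) → V :=
    Sum.elim φ (fun x => g x.1 (x.2 + 1))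
  have hFX : ∀ (e : Edges H) (i : Fin (L e - 1)), g e (i + 1) ∈ X e.1 := fun e i =>
    h_internal e i (by have := i.2; omega)
  have hFinj : Function.Injective F := by
    rintro (u | ⟨e, i⟩) (v | ⟨e', j⟩) h
    · exact congrArg _ (hφ h)
    · exact absurd ⟨u, h⟩ (M.notMem _ (hJ e') _ (hFX e' j))
    · exact absurd ⟨v, h.symm⟩ (M.notMem _ (hJ e) _ (hFX e i))
    · have h' : g e (i + 1) = g e' (j + 1) := h
      by_cases hee : e = e'
      · subst hee
        have := ginj e _ (by have := i.2; omega) _ (by have := j.2; omega) h'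
        have : i = j := Fin.ext (by omega)
        rw [this]
      · have hX := hFX e' j
        rw [← h'] at hX
        exact absurd hX (M.disj _ (hJ e) _ (hJ e') (fun hh => hee (Subtype.ext hh)) _ (hFX e i))
  have hmix : ∀ (u : Fin n) (e : Edges H) (i : Fin (L e - 1)),
      G.Adj (φ u) (g e (i + 1)) ↔
        (u = e.1.1 ∧ (i : ℕ) = 0) ∨ (u = e.1.2 ∧ (i : ℕ) + 1 = L e - 1) := by
    intro u e i
    have hi := i.2
    have hLe := hL e
    constructor
    · intro h
      rcases M.attach _ (hJ e) _ (hFX e i) _ ⟨u, rfl⟩ h with h' | h'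
      · have hu : u = e.1.1 := hφ h'
        subst hu
        rw [← g0, gadj e _ (by omega) _ (by omega)] at h
        exact Or.inl ⟨rfl, by omega⟩
      · have hu : u = e.1.2 := hφ h'
        subst hu
        rw [← gL, gadj e _ (by omega) _ (by omega)] at h
        exact Or.inr ⟨rfl, by omega⟩
    · rintro (⟨rfl, h⟩ | ⟨rfl, h⟩)
      · rw [← g0, gadj e _ (by omega) _ (by omega)]
        omega
      · rw [← gL, gadj e _ (by omega) _ (by omega)]
        omega
  refine ⟨fun e => L e - 1, ⟨⟨⟨F, hFinj⟩, ?_⟩⟩⟩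
  rintro (u | ⟨e, i⟩) (v | ⟨e', j⟩)
  · simp only [Subdiv, fromRel_adj, subdivRel, F, Function.Embedding.coeFn_mk, Sum.elim_inl]
    constructor
    · exact fun h => absurd h (M.indep _ ⟨u, rfl⟩ _ ⟨v, rfl⟩)
    · rintro ⟨-, ⟨h, h'⟩ | ⟨h, h'⟩⟩
      · have := hL ⟨(u, v), h⟩
        omega
      · have := hL ⟨(v, u), h⟩
        omega
  · simp only [Subdiv, fromRel_adj, subdivRel, F, Function.Embedding.coeFn_mk, Sum.elim_inl,
      Sum.elim_inr, or_false]
    rw [hmix]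
    simp
  · simp only [Subdiv, fromRel_adj, subdivRel, F, Function.Embedding.coeFn_mk, Sum.elim_inl,
      Sum.elim_inr, false_or]
    rw [G.adj_comm, hmix]
    simp
  · simp only [Subdiv, fromRel_adj, subdivRel, F, Function.Embedding.coeFn_mk, Sum.elim_inr]
    by_cases hee : e = e'
    · subst hee
      have hi : (i : ℕ) < L e - 1 := i.2
      have hj : (j : ℕ) < L e - 1 := j.2
      rw [gadj e _ (by omega) _ (by omega)]
      simp only [true_and, ne_eq, Sum.inr.injEq, Sigma.mk.injEq, heq_eq_eq]
      constructor
      · intro h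
        refine ⟨?_, by omega⟩
        rintro rfl
        omega
      · rintro ⟨-, h⟩
        omega
    · constructor
      · intro h
        exact absurd h (M.anti _ (hJ e) _ (hJ e') (fun hh => hee (Subtype.ext hh)) _ (hFX e i) _
          (hFX e' j))
      · rintro ⟨-, ⟨h, -⟩ | ⟨h, -⟩⟩
        · exact absurd h hee
        · exact absurd h.symm hee

/-- A dense induced model contains an induced subdivision of any prescribed graph. -/
lemma exists_induced_subdiv_of_dense {n : ℕ} (H : SimpleGraph (Fin n)) :
    ∃ D' : ℕ, ∀ {V ι : Type} {G : SimpleGraph V} {A : Finset V} {J : Finset ι} {a b : ι → V}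
      {I : ι → Set V}, InducedModel G (A : Set V) (J : Set ι) a b I → D' * A.card < J.card →
      ∃ t : Edges H → ℕ, IsInducedSubgraphOf (Subdiv H t) G := by
  obtain ⟨c, -, hc⟩ := exists_topological_model
    (Finset.univ.filter (fun p : Fin n × Fin n => p.1 < p.2 ∧ H.Adj p.1 p.2))
  refine ⟨c, ?_⟩
  intro V ι G A J a b I M hd
  let K : SimpleGraph V := SimpleGraph.fromRel (fun x y => ∃ i ∈ J, a i = x ∧ b i = y)
  have hK : ∀ x y, K.Adj x y → ∃ i ∈ (J : Set ι), s(a i, b i) = s(x, y) := by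
    intro x y h
    rcases h with ⟨-, ⟨i, hi, rfl, rfl⟩ | ⟨i, hi, rfl, rfl⟩⟩
    · exact ⟨i, hi, rfl⟩
    · exact ⟨i, hi, Sym2.eq_swap⟩
  have hJ : J.Nonempty := by
    rw [← Finset.card_pos]
    omega
  obtain ⟨i₀, hi₀⟩ := hJ
  have hle : J.card ≤ degSum K A := by
    have : degSum K A = (A.sigma (fun x => nbrIn K A x)).card := by
      rw [Finset.card_sigma]
      rfl
    rw [this]
    refine Finset.card_le_card_of_injOn (fun i => (⟨a i, b i⟩ : Σ _ : V, V)) ?_ ?_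
    · intro i hi
      simp only [Finset.coe_sigma, Set.mem_sigma_iff, Finset.mem_coe, mem_nbrIn]
      exact ⟨M.left_mem i hi, M.right_mem i hi, M.ne i hi, Or.inl ⟨i, hi, rfl, rfl⟩⟩
    · intro i hi j hj hij
      simp only [Sigma.mk.injEq, heq_eq_eq] at hij
      exact M.inj i hi j hj (by rw [hij.1, hij.2])
  obtain ⟨φ, C, hφ, hφA, hC⟩ := hc K A ⟨a i₀, M.left_mem i₀ hi₀⟩ (by omega)
  obtain ⟨X, MX⟩ := M.comp hK (fun e he => (Finset.mem_filter.1 he).2.1) hφ hφA hC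
  exact MX.exists_subdiv hφ (fun e => by simpa using e.2)

end InducedSubdivisions

/-! ## Counting in graphs without bicliques -/

section Counting

variable {V : Type}

lemma exists_bounded_degree_half {G : SimpleGraph V} {m : ℕ} {W : Finset V}
    (h : degSum G W ≤ m * W.card) :
    ∃ L ⊆ W, W.card ≤ 2 * L.card ∧ ∀ v ∈ L, (nbrIn G W v).card ≤ 2 * m := by
  refine ⟨W.filter (fun v => (nbrIn G W v).card ≤ 2 * m), Finset.filter_subset _ _, ?_,
    fun v hv => (Finset.mem_filter.1 hv).2⟩
  have h1 := Finset.card_filter_add_card_filter_not (s := W)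
    (fun v => (nbrIn G W v).card ≤ 2 * m)
  set B := W.filter (fun v => ¬ (nbrIn G W v).card ≤ 2 * m) with hB
  have h2 : B.card * (2 * m + 1) ≤ degSum G W := by
    refine le_trans ?_ (Finset.sum_le_sum_of_subset (Finset.filter_subset
      (fun v => ¬ (nbrIn G W v).card ≤ 2 * m) W))
    rw [← smul_eq_mul]
    refine Finset.card_nsmul_le_sum _ _ _ (fun v hv => ?_)
    have := (Finset.mem_filter.1 hv).2
    omega
  by_contra hlt
  have h3 : W.card < 2 * B.card := by omega
  have h4 : m * W.card ≤ m * (2 * B.card) := Nat.mul_le_mul_left _ h3.le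
  nlinarith

/-- A dense graph has a subset of large minimum degree whose density is nearly extremal. -/
lemma exists_extremal_subset [Fintype V] {G : SimpleGraph V} {K : ℕ} {W₀ : Finset V}
    (h : 2 * K * W₀.card < degSum G W₀) :
    ∃ (k : ℕ) (W : Finset V), K < k ∧ W.Nonempty ∧
      (∀ W' : Finset V, degSum G W' ≤ 2 * k * W'.card) ∧ ∀ v ∈ W, k ≤ (nbrIn G W v).card := by
  have hex : ∃ k : ℕ, ∀ W' : Finset V, degSum G W' ≤ 2 * k * W'.card := by
    refine ⟨Fintype.card V, fun W' => ?_⟩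
    have h1 : degSum G W' ≤ W'.card * Fintype.card V := by
      unfold degSum
      rw [← smul_eq_mul]
      exact Finset.sum_le_card_nsmul _ _ _ (fun v _ => Finset.card_le_univ _)
    nlinarith
  have hk := Nat.find_spec hex
  set k := Nat.find hex with hkdef
  have hKk : K < k := by
    by_contra hle
    have := hk W₀
    have : 2 * k * W₀.card ≤ 2 * K * W₀.card := Nat.mul_le_mul_right _ (by omega)
    omega
  have hk1 := Nat.find_min hex (m := k - 1) (by omega)
  push Not at hk1
  have hex' : ∃ n, ∃ W : Finset V, W.card = n ∧ 2 * (k - 1) * W.card < degSum G W := by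
    obtain ⟨W, hW⟩ := hk1
    exact ⟨_, W, rfl, hW⟩
  obtain ⟨W, hn, hW⟩ := Nat.find_spec hex'
  refine ⟨k, W, hKk, ?_, hk, ?_⟩
  · by_contra hne
    rw [Finset.not_nonempty_iff_eq_empty] at hne
    subst hne
    simp [degSum] at hW
  · intro v hv
    have h1 := degSum_erase G hv
    have h2 := Finset.card_erase_add_one hv
    have h3 : degSum G (W.erase v) ≤ 2 * (k - 1) * (W.erase v).card := by
      by_contra hlt
      push Not at hlt
      exact Nat.find_min hex' (m := (W.erase v).card) (by omega) ⟨_, rfl, hlt⟩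
    rw [← h2] at hW
    have h4 : 2 * (k - 1) * ((W.erase v).card + 1) =
      2 * (k - 1) * (W.erase v).card + 2 * (k - 1) := by ring
    omega

lemma pow_le_choose_add (c s : ℕ) : c ^ s ≤ 2 ^ s * s.factorial * c.choose s + (2 * s) ^ s := by
  by_cases hc : c ≤ 2 * s
  · exact (Nat.pow_le_pow_left hc s).trans (Nat.le_add_left _ _)
  · have h1 : c ≤ 2 * (c + 1 - s) := by omega
    have h2 := Nat.pow_sub_le_descFactorial c s
    rw [Nat.descFactorial_eq_factorial_mul_choose] at h2
    calc c ^ s ≤ (2 * (c + 1 - s)) ^ s := Nat.pow_le_pow_left h1 s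
      _ = 2 ^ s * (c + 1 - s) ^ s := mul_pow _ _ _
      _ ≤ 2 ^ s * (s.factorial * c.choose s) := Nat.mul_le_mul_left _ h2
      _ ≤ _ := by rw [← mul_assoc]; exact Nat.le_add_right _ _

/-- In a graph without bicliques, codegrees inside a neighbourhood are small on average. -/
lemma sum_codegree_pow_le {G : SimpleGraph V} {s : ℕ} (hs : 1 ≤ s) (hG : ¬ HasBiclique G s) {M : ℕ}
    {W B C : Finset V} (hB : B.card ≤ M) (hC : C.card ≤ M) :
    ∑ v ∈ C, (B ∩ nbrIn G W v).card ^ s ≤ (2 ^ s * s + (2 * s) ^ s) * M ^ s := by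
  have h1 : ∑ v ∈ C, (B ∩ nbrIn G W v).card.choose s ≤ s * B.card.choose s := by
    have e1 : ∀ v, (B ∩ nbrIn G W v).card.choose s =
        ∑ R ∈ B.powersetCard s, if R ⊆ nbrIn G W v then 1 else 0 := by
      intro v
      rw [← Finset.card_powersetCard, Finset.sum_boole]
      simp only [Nat.cast_id]
      congr 1
      ext R
      simp only [Finset.mem_powersetCard, Finset.mem_filter, Finset.subset_inter_iff]
      tauto
    simp only [e1]
    rw [Finset.sum_comm, mul_comm, ← Finset.card_powersetCard, ← smul_eq_mul]
    refine Finset.sum_le_card_nsmul _ _ _ (fun R hR => ?_)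
    rw [Finset.sum_boole]
    by_contra hlt
    simp only [Nat.cast_id, not_le] at hlt
    obtain ⟨T, hT, hTs⟩ := Finset.exists_subset_card_eq hlt.le
    refine hG ⟨T, R, hTs, (Finset.mem_powersetCard.1 hR).2, fun x hx y hy => ?_⟩
    exact (mem_nbrIn.1 ((Finset.mem_filter.1 (hT hx)).2 hy)).2
  calc ∑ v ∈ C, (B ∩ nbrIn G W v).card ^ s
      ≤ ∑ v ∈ C, (2 ^ s * s.factorial * (B ∩ nbrIn G W v).card.choose s + (2 * s) ^ s) :=
        Finset.sum_le_sum (fun v _ => pow_le_choose_add _ _)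
    _ = 2 ^ s * s.factorial * (∑ v ∈ C, (B ∩ nbrIn G W v).card.choose s) +
          C.card * (2 * s) ^ s := by
        rw [Finset.sum_add_distrib, Finset.mul_sum, Finset.sum_const, smul_eq_mul]
    _ ≤ 2 ^ s * s.factorial * (s * B.card.choose s) + M ^ s * (2 * s) ^ s := by
        refine add_le_add (Nat.mul_le_mul_left _ h1) (Nat.mul_le_mul_right _ (hC.trans ?_))
        exact Nat.le_self_pow (by omega) _
    _ = 2 ^ s * s * (s.factorial * B.card.choose s) + M ^ s * (2 * s) ^ s := by ring
    _ ≤ 2 ^ s * s * M ^ s + M ^ s * (2 * s) ^ s := by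
        refine Nat.add_le_add_right (Nat.mul_le_mul_left _ ?_) _
        rw [← Nat.descFactorial_eq_factorial_mul_choose]
        exact (Nat.descFactorial_le_pow _ _).trans (Nat.pow_le_pow_left hB s)
    _ = _ := by ring

lemma card_pairs_inter_le {M : ℕ} {B₁ B₂ : Finset V} (h₁ : B₁.card ≤ M) (h₂ : B₂.card ≤ M)
    (s j : ℕ) :
    ((B₁.powersetCard s ×ˢ B₂.powersetCard s).filter (fun T => (T.1 ∩ T.2).card = j)).card ≤
      (B₁ ∩ B₂).card ^ j * (M ^ (s - j) * M ^ (s - j)) := by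
  have h3 : ∀ (B : Finset V) (i : ℕ), B.card ≤ M → (B.powersetCard i).card ≤ M ^ i := by
    intro B i hB
    rw [Finset.card_powersetCard]
    exact (Nat.choose_le_pow _ _).trans (Nat.pow_le_pow_left hB i)
  have h4 : ((B₁ ∩ B₂).powersetCard j ×ˢ (B₁.powersetCard (s - j) ×ˢ
      B₂.powersetCard (s - j))).card ≤ (B₁ ∩ B₂).card ^ j * (M ^ (s - j) * M ^ (s - j)) := by
    rw [Finset.card_product, Finset.card_product]
    refine Nat.mul_le_mul ?_ (Nat.mul_le_mul (h3 _ _ h₁) (h3 _ _ h₂))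
    rw [Finset.card_powersetCard]
    exact Nat.choose_le_pow _ _
  refine le_trans (Finset.card_le_card_of_injOn
    (fun T => (T.1 ∩ T.2, T.1 \ T.2, T.2 \ T.1)) ?_ ?_) h4
  · rintro ⟨T₁, T₂⟩ hT
    simp only [Finset.coe_filter, Finset.mem_product, Finset.mem_powersetCard,
      Set.mem_ofPred_eq] at hT
    obtain ⟨⟨⟨a1, a2⟩, a3, a4⟩, a5⟩ := hT
    have e1 := Finset.card_sdiff_add_card_inter T₁ T₂
    have e2 := Finset.card_sdiff_add_card_inter T₂ T₁
    rw [Finset.inter_comm] at e2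
    simp only [Finset.coe_product, Set.mem_prod, Finset.mem_coe, Finset.mem_powersetCard]
    exact ⟨⟨Finset.inter_subset_inter a1 a3, a5⟩, ⟨Finset.sdiff_subset.trans a1, by omega⟩,
      Finset.sdiff_subset.trans a3, by omega⟩
  · rintro ⟨T₁, T₂⟩ - ⟨T₁', T₂'⟩ - h
    simp only [Prod.mk.injEq] at h
    obtain ⟨e1, e2, e3⟩ := h
    have f1 : T₁ = T₁' := by
      rw [← Finset.sdiff_union_inter T₁ T₂, ← Finset.sdiff_union_inter T₁' T₂', e1, e2]
    have f2 : T₂ = T₂' := by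
      rw [← Finset.sdiff_union_inter T₂ T₁, ← Finset.sdiff_union_inter T₂' T₁', e3,
        Finset.inter_comm, e1, Finset.inter_comm]
    rw [f1, f2]

lemma sum_pairs_pow_le {M : ℕ} {B₁ B₂ : Finset V} (h₁ : B₁.card ≤ M) (h₂ : B₂.card ≤ M)
    (hM : 1 ≤ M) (s : ℕ) {y : ℝ} (hy : 0 ≤ y) :
    ∑ T₁ ∈ B₁.powersetCard s, ∑ T₂ ∈ B₂.powersetCard s, (y / M) ^ (T₁ ∪ T₂).card ≤
      (s + 1) * y ^ s * (((B₁ ∩ B₂).card / M : ℝ) ^ s + y ^ s) := by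
  have hM' : (0 : ℝ) < M := by exact_mod_cast hM
  rw [← Finset.sum_product' (f := fun T₁ T₂ : Finset V => (y / M) ^ (T₁ ∪ T₂).card)]
  have hmaps : ∀ T ∈ B₁.powersetCard s ×ˢ B₂.powersetCard s,
      (T.1 ∩ T.2).card ∈ Finset.range (s + 1) := by
    intro T hT
    simp only [Finset.mem_product, Finset.mem_powersetCard] at hT
    have := Finset.card_le_card (Finset.inter_subset_left (s₁ := T.1) (s₂ := T.2))
    rw [Finset.mem_range]
    omega
  rw [← Finset.sum_fiberwise_of_maps_to hmaps]
  have hterm : ∀ j ∈ Finset.range (s + 1),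
      ∑ T ∈ (B₁.powersetCard s ×ˢ B₂.powersetCard s).filter (fun T => (T.1 ∩ T.2).card = j),
        (y / M) ^ (T.1 ∪ T.2).card ≤ y ^ s * (((B₁ ∩ B₂).card / M : ℝ) ^ s + y ^ s) := by
    intro j hj
    obtain ⟨i, rfl⟩ : ∃ i, s = j + i := ⟨s - j, by rw [Finset.mem_range] at hj; omega⟩
    have hc := card_pairs_inter_le h₁ h₂ (j + i) j
    rw [Nat.add_sub_cancel_left] at hc
    have hz : (0 : ℝ) ≤ (B₁ ∩ B₂).card / M := by positivity
    set z : ℝ := (B₁ ∩ B₂).card / M with hzdef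
    have hmix : z ^ j * y ^ i ≤ z ^ (j + i) + y ^ (j + i) := by
      rcases le_total z y with h | h
      · calc z ^ j * y ^ i ≤ y ^ j * y ^ i := by gcongr
          _ = y ^ (j + i) := (pow_add _ _ _).symm
          _ ≤ _ := le_add_of_nonneg_left (by positivity)
      · calc z ^ j * y ^ i ≤ z ^ j * z ^ i := by gcongr
          _ = z ^ (j + i) := (pow_add _ _ _).symm
          _ ≤ _ := le_add_of_nonneg_right (by positivity)
    calc _ = ∑ T ∈ (B₁.powersetCard (j + i) ×ˢ B₂.powersetCard (j + i)).filter
          (fun T => (T.1 ∩ T.2).card = j), (y / M) ^ (j + i + i) := by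
          refine Finset.sum_congr rfl (fun T hT => ?_)
          simp only [Finset.mem_filter, Finset.mem_product, Finset.mem_powersetCard] at hT
          have := Finset.card_union_add_card_inter T.1 T.2
          congr 1
          omega
      _ = (((B₁.powersetCard (j + i) ×ˢ B₂.powersetCard (j + i)).filter
          (fun T => (T.1 ∩ T.2).card = j)).card : ℝ) * (y / M) ^ (j + i + i) := by
          rw [Finset.sum_const, nsmul_eq_mul]
      _ ≤ ((B₁ ∩ B₂).card ^ j * (M ^ i * M ^ i) : ℝ) * (y / M) ^ (j + i + i) := by
          refine mul_le_mul_of_nonneg_right ?_ (by positivity)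
          exact_mod_cast hc
      _ = y ^ (j + i) * (z ^ j * y ^ i) := by
          rw [hzdef]
          simp only [div_pow, pow_add]
          field_simp
      _ ≤ _ := mul_le_mul_of_nonneg_left hmix (by positivity)
  refine (Finset.sum_le_sum hterm).trans (le_of_eq ?_)
  rw [Finset.sum_const, Finset.card_range, nsmul_eq_mul]
  push_cast
  ring

end Counting

section SparseSample

variable {V : Type} [Fintype V]

/-- Expected number of adjacent pairs of vertices both of which have `s` sampled neighbours. -/
lemma expect_conflicts_le {G : SimpleGraph V} {s M N : ℕ} [NeZero N] (hs : 1 ≤ s)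
    (hG : ¬ HasBiclique G s) (hM : 1 ≤ M) {y : ℝ} (hy : 0 ≤ y) (hN : 1 / (N : ℝ) = y / M)
    {W L : Finset V} (hL : L ⊆ W) (hmax : ∀ v ∈ L, (nbrIn G W v).card ≤ M) :
    Finset.expect Finset.univ (fun f : V → Fin N => ∑ u ∈ L, ∑ v ∈ nbrIn G L u,
      ∑ T₁ ∈ (nbrIn G W u).powersetCard s, ∑ T₂ ∈ (nbrIn G W v).powersetCard s,
        if ∀ x ∈ T₁ ∪ T₂, f x = 0 then (1 : ℝ) else 0) ≤
      L.card * ((s + 1) * y ^ s * ((2 ^ s * s + (2 * s) ^ s) + M * y ^ s)) := by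
  have hM' : (0 : ℝ) < M := by exact_mod_cast hM
  simp only [Finset.expect_sum_comm, expect_forall_zero, hN]
  rw [← nsmul_eq_mul]
  refine Finset.sum_le_card_nsmul _ _ _ (fun u hu => ?_)
  have hC : (nbrIn G L u).card ≤ M :=
    (Finset.card_le_card (Finset.filter_subset_filter _ hL)).trans (hmax u hu)
  have h1 := sum_codegree_pow_le hs hG (W := W) (hmax u hu) hC
  have h2 : ∑ v ∈ nbrIn G L u, ((nbrIn G W u ∩ nbrIn G W v).card / M : ℝ) ^ s ≤
      2 ^ s * s + (2 * s) ^ s := by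
    simp only [div_pow]
    rw [← Finset.sum_div, div_le_iff₀ (by positivity)]
    exact_mod_cast h1
  calc _ ≤ ∑ v ∈ nbrIn G L u,
        (s + 1) * y ^ s * (((nbrIn G W u ∩ nbrIn G W v).card / M : ℝ) ^ s + y ^ s) :=
        Finset.sum_le_sum (fun v hv => sum_pairs_pow_le (hmax u hu)
          (hmax v (mem_nbrIn.1 hv).1) hM s hy)
    _ = (s + 1) * y ^ s * (∑ v ∈ nbrIn G L u, ((nbrIn G W u ∩ nbrIn G W v).card / M : ℝ) ^ s +
          (nbrIn G L u).card * y ^ s) := by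
        rw [← Finset.mul_sum, Finset.sum_add_distrib, Finset.sum_const, nsmul_eq_mul]
    _ ≤ _ := by
        have : ((nbrIn G L u).card : ℝ) ≤ M := by exact_mod_cast hC
        gcongr

/-- Expected number of vertices with exactly `s` sampled neighbours, for which in addition
prescribed small sets are not sampled. -/
lemma le_expect_good {G : SimpleGraph V} {s k N : ℕ} [NeZero N] (hk : 2 * s ≤ k) (hk0 : 1 ≤ k)
    {y : ℝ} (hy : 0 ≤ y) (hN : 1 / (N : ℝ) = y / (4 * k : ℕ)) {W L : Finset V}
    (hmin : ∀ v ∈ L, k ≤ (nbrIn G W v).card) (bad : V → Finset V → Finset V)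
    (hdisj : ∀ v T, Disjoint T (bad v T))
    (hbad : ∀ v ∈ L, ∀ T ∈ (nbrIn G W v).powersetCard s, 2 * (bad v T).card ≤ N) :
    L.card * (y ^ s / (8 ^ s * 2 * s.factorial)) ≤
    Finset.expect Finset.univ (fun f : V → Fin N => ∑ v ∈ L,
      ∑ T ∈ (nbrIn G W v).powersetCard s,
        if (∀ x ∈ T, f x = 0) ∧ ∀ x ∈ bad v T, f x ≠ 0 then (1 : ℝ) else 0) := by
  have hNpos : (0 : ℝ) < N := by exact_mod_cast Nat.pos_of_ne_zero (NeZero.ne N)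
  have hkpos : (0 : ℝ) < k := by exact_mod_cast hk0
  simp only [Finset.expect_sum_comm]
  rw [← nsmul_eq_mul]
  refine Finset.card_nsmul_le_sum _ _ _ (fun v hv => ?_)
  have h1 : ∀ T ∈ (nbrIn G W v).powersetCard s, (y / (4 * k : ℕ)) ^ s * (1 / 2) ≤
      Finset.expect Finset.univ (fun f : V → Fin N =>
        if (∀ x ∈ T, f x = 0) ∧ ∀ x ∈ bad v T, f x ≠ 0 then (1 : ℝ) else 0) := by
    intro T hT
    refine le_trans ?_ (expect_good_ge T (bad v T) (hdisj v T))
    rw [hN, (Finset.mem_powersetCard.1 hT).2]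
    refine mul_le_mul_of_nonneg_left ?_ (by positivity)
    have h2 : (2 * (bad v T).card : ℝ) ≤ N := by exact_mod_cast hbad v hv T hT
    have : ((bad v T).card : ℝ) / N ≤ 1 / 2 := by
      rw [div_le_iff₀ hNpos]
      linarith
    linarith
  refine le_trans ?_ (Finset.card_nsmul_le_sum _ _ _ h1)
  rw [nsmul_eq_mul, Finset.card_powersetCard]
  have h2 : (k : ℝ) ^ s ≤ 2 ^ s * s.factorial * ((nbrIn G W v).card.choose s : ℝ) := by
    have e1 : k ≤ 2 * (k + 1 - s) := by omega
    have e2 := Nat.pow_sub_le_descFactorial k s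
    rw [Nat.descFactorial_eq_factorial_mul_choose] at e2
    have e3 : k ^ s ≤ 2 ^ s * s.factorial * (nbrIn G W v).card.choose s := by
      calc k ^ s ≤ (2 * (k + 1 - s)) ^ s := Nat.pow_le_pow_left e1 s
        _ = 2 ^ s * (k + 1 - s) ^ s := mul_pow _ _ _
        _ ≤ 2 ^ s * (s.factorial * k.choose s) := Nat.mul_le_mul_left _ e2
        _ = 2 ^ s * s.factorial * k.choose s := by ring
        _ ≤ _ := Nat.mul_le_mul_left _ (Nat.choose_le_choose _ (hmin v hv))
    exact_mod_cast e3
  have hf : (0 : ℝ) < s.factorial := by exact_mod_cast Nat.factorial_pos s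
  push_cast
  rw [div_pow, mul_pow]
  have h8 : (8 : ℝ) ^ s = 2 ^ s * 4 ^ s := by rw [← mul_pow]; norm_num
  rw [h8, div_le_iff₀ (by positivity)]
  have e : ((nbrIn G W v).card.choose s : ℝ) * (y ^ s / (4 ^ s * k ^ s) * (1 / 2)) *
      (2 ^ s * 4 ^ s * 2 * s.factorial) =
      (2 ^ s * s.factorial * ((nbrIn G W v).card.choose s : ℝ)) / k ^ s * y ^ s := by
    field_simp
  rw [e]
  refine le_mul_of_one_le_left (by positivity) ?_
  rwa [one_le_div (by positivity)]

lemma exists_root (s k h₀ : ℕ) (hs : 1 ≤ s) (hk : (h₀ + 1) ^ s < k) :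
    ∃ h, h₀ < h ∧ k ≤ h ^ s ∧ h ^ s ≤ 2 ^ s * k := by
  have hex : ∃ h, k ≤ h ^ s := ⟨k, Nat.le_self_pow (by omega) k⟩
  have h1 := Nat.find_spec hex
  set h := Nat.find hex with hdef
  have h2 : h₀ + 1 < h := by
    by_contra hle
    have := Nat.pow_le_pow_left (not_lt.1 hle) s
    omega
  refine ⟨h, by omega, h1, ?_⟩
  have h3 := Nat.find_min hex (m := h - 1) (by omega)
  calc h ^ s ≤ (2 * (h - 1)) ^ s := Nat.pow_le_pow_left (by omega) s
    _ = 2 ^ s * (h - 1) ^ s := mul_pow _ _ _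
    _ ≤ _ := Nat.mul_le_mul_left _ (by omega)

lemma degSum_le_conflicts {G : SimpleGraph V} {s N : ℕ} [NeZero N] {W L S : Finset V} (hS : S ⊆ L)
    (f : V → Fin N)
    (h : ∀ v ∈ S, ∃ T ∈ (nbrIn G W v).powersetCard s, ∀ x ∈ T, f x = 0) :
    (degSum G S : ℝ) ≤ ∑ u ∈ L, ∑ v ∈ nbrIn G L u,
      ∑ T₁ ∈ (nbrIn G W u).powersetCard s, ∑ T₂ ∈ (nbrIn G W v).powersetCard s,
        if ∀ x ∈ T₁ ∪ T₂, f x = 0 then (1 : ℝ) else 0 := by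
  have hnn : ∀ u v : V, (0 : ℝ) ≤ ∑ T₁ ∈ (nbrIn G W u).powersetCard s,
      ∑ T₂ ∈ (nbrIn G W v).powersetCard s,
        if ∀ x ∈ T₁ ∪ T₂, f x = 0 then (1 : ℝ) else 0 := fun u v =>
    Finset.sum_nonneg fun _ _ => Finset.sum_nonneg fun _ _ => by split_ifs <;> norm_num
  unfold degSum
  push_cast
  refine le_trans (Finset.sum_le_sum (fun u hu => ?_)) (Finset.sum_le_sum_of_subset_of_nonneg hS
    (fun u _ _ => Finset.sum_nonneg fun v _ => hnn u v))
  refine le_trans ?_ (Finset.sum_le_sum_of_subset_of_nonneg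
    (Finset.filter_subset_filter _ hS : nbrIn G S u ⊆ nbrIn G L u) (fun v _ _ => hnn u v))
  rw [← nsmul_one]
  refine Finset.card_nsmul_le_sum _ _ _ (fun v hv => ?_)
  obtain ⟨T₁, hT₁, h₁⟩ := h u hu
  obtain ⟨T₂, hT₂, h₂⟩ := h v (mem_nbrIn.1 hv).1
  have hnn1 : ∀ T₁ T₂ : Finset V, (0 : ℝ) ≤ if ∀ x ∈ T₁ ∪ T₂, f x = 0 then (1 : ℝ) else 0 :=
    fun _ _ => by split_ifs <;> norm_num
  refine le_trans ?_ (Finset.single_le_sum (fun T _ => Finset.sum_nonneg fun T' _ => hnn1 T T') hT₁)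
  refine le_trans ?_ (Finset.single_le_sum (fun T' _ => hnn1 T₁ T') hT₂)
  rw [if_pos]
  intro x hx
  rcases Finset.mem_union.1 hx with hx | hx
  · exact h₁ x hx
  · exact h₂ x hx

/-- Random sampling in a dense graph without bicliques produces a small set `A` and many vertices
with exactly `s` neighbours in `A`, in such a way that the relevant induced subgraphs are sparse. -/
lemma exists_sparse_sample (s : ℕ) (hs : 1 ≤ s) : ∃ m : ℕ, ∀ β : ℕ, ∃ K : ℕ,
    ∀ {V : Type} [Fintype V] (G : SimpleGraph V), ¬ HasBiclique G s → ∀ k, K < k →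
    ∀ (W L : Finset V) (out : V → Finset V), L ⊆ W → W.card ≤ 2 * L.card → L.Nonempty →
    (∀ v ∈ L, k ≤ (nbrIn G W v).card) → (∀ v ∈ L, (nbrIn G W v).card ≤ 4 * k) →
    (∀ v, (out v).card ≤ 2 * k) →
    ∃ S A : Finset V, S ⊆ L ∧ degSum G S ≤ m * S.card ∧ β * A.card < S.card ∧
      ∀ v ∈ S, v ∉ A ∧ (nbrIn G A v).card = s ∧ ∀ w ∈ nbrIn G A v, (out w ∩ A).card ≤ s := by
  obtain ⟨g, hg⟩ : ∃ g, g = 8 ^ s * 2 * s.factorial := ⟨_, rfl⟩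
  have hg0 : 0 < g := by
    rw [hg]
    have := Nat.factorial_pos s
    positivity
  obtain ⟨c, hc⟩ : ∃ c, c = (s + 1) * ((2 ^ s * s + (2 * s) ^ s) + 4) := ⟨_, rfl⟩
  have hc0 : 0 < c := by rw [hc]; positivity
  refine ⟨4 * c * g, fun β => ?_⟩
  obtain ⟨h₀, hh₀⟩ : ∃ h₀, h₀ = 2 * β * 2 ^ s * g + s + 5 := ⟨_, rfl⟩
  refine ⟨(h₀ + 1) ^ s + 2 * s, ?_⟩
  intro V _ G hG k hk W L out hLW hWL hLne hmin hmax hout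
  obtain ⟨h, hh, hkh, hhk⟩ := exists_root s k h₀ hs (by omega)
  have hk0 : 1 ≤ k := by omega
  have hh0 : 0 < h := by omega
  obtain ⟨N, hNdef⟩ : ∃ N, N = 4 * k * h := ⟨_, rfl⟩
  have : NeZero N := ⟨by rw [hNdef]; positivity⟩
  have hkR : (0 : ℝ) < k := by exact_mod_cast hk0
  have hhR : (0 : ℝ) < h := by exact_mod_cast hh0
  have hgR : (0 : ℝ) < g := by exact_mod_cast hg0
  have hcR : (0 : ℝ) < c := by exact_mod_cast hc0
  obtain ⟨y, hy⟩ : ∃ y : ℝ, y = 1 / h := ⟨_, rfl⟩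
  have hy0 : 0 < y := by rw [hy]; positivity
  have hN : 1 / (N : ℝ) = y / (4 * k : ℕ) := by
    rw [hy, hNdef]
    push_cast
    field_simp
  let bad : V → Finset V → Finset V := fun v T =>
    (insert v (nbrIn G W v) ∪ T.biUnion out) \ T
  have hdisj : ∀ v T, Disjoint T (bad v T) := fun v T => Finset.disjoint_sdiff
  have hbad : ∀ v ∈ L, ∀ T ∈ (nbrIn G W v).powersetCard s, 2 * (bad v T).card ≤ N := by
    intro v hv T hT
    have h1 : (bad v T).card ≤ (insert v (nbrIn G W v) ∪ T.biUnion out).card :=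
      Finset.card_le_card Finset.sdiff_subset
    have h2 := Finset.card_union_le (insert v (nbrIn G W v)) (T.biUnion out)
    have h3 := Finset.card_insert_le v (nbrIn G W v)
    have h4 := hmax v hv
    have h5 : (T.biUnion out).card ≤ T.card * (2 * k) :=
      Finset.card_biUnion_le_card_mul _ _ _ (fun x _ => hout x)
    rw [(Finset.mem_powersetCard.1 hT).2] at h5
    have h6 : k * (s + 5) ≤ k * h := Nat.mul_le_mul_left _ (by omega)
    rw [hNdef]
    nlinarith
  have hE1 := le_expect_good (by omega) hk0 hy0.le hN hmin bad hdisj hbad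
  have hE2 := expect_conflicts_le hs hG (by omega) hy0.le hN hLW hmax
  have hE3 : Finset.expect Finset.univ (fun f : V → Fin N =>
      ∑ x ∈ W, if ∀ z ∈ ({x} : Finset V), f z = 0 then (1 : ℝ) else 0) = W.card * (1 / N) := by
    simp only [Finset.expect_sum_comm, expect_forall_zero, Finset.card_singleton, pow_one,
      Finset.sum_const, nsmul_eq_mul]
  have hLpos : (0 : ℝ) < L.card := by exact_mod_cast hLne.card_pos
  have hB2 : (4 * k : ℕ) * y ^ s ≤ 4 := by
    have : (k : ℝ) ≤ h ^ s := by exact_mod_cast hkh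
    rw [hy, div_pow, one_pow, mul_one_div, div_le_iff₀ (by positivity)]
    push_cast
    linarith
  have hB3 : (β : ℝ) * (W.card * (1 / N)) ≤ L.card * y ^ s / (4 * g) := by
    have e1 : (W.card : ℝ) ≤ 2 * L.card := by exact_mod_cast hWL
    have e2 : (1 : ℝ) / k ≤ 2 ^ s * y ^ s := by
      have : (h : ℝ) ^ s ≤ 2 ^ s * k := by exact_mod_cast hhk
      rw [hy, div_pow, one_pow, mul_one_div, div_le_div_iff₀ hkR (by positivity)]
      linarith
    have e3 : (2 * β * 2 ^ s * g : ℝ) ≤ h := by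
      have : 2 * β * 2 ^ s * g ≤ h := by omega
      exact_mod_cast this
    have e4 : (1 : ℝ) / N = (1 / k) * (1 / (4 * h)) := by
      rw [hNdef]
      push_cast
      field_simp
    calc (β : ℝ) * (W.card * (1 / N)) ≤ β * ((2 * L.card) * ((2 ^ s * y ^ s) * (1 / (4 * h)))) := by
          rw [e4]
          gcongr
      _ = L.card * y ^ s * ((2 * β * 2 ^ s * g) / h) / (4 * g) := by
          field_simp
      _ ≤ L.card * y ^ s * 1 / (4 * g) := by
          have : (2 * β * 2 ^ s * g : ℝ) / h ≤ 1 := (div_le_one hhR).2 e3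
          gcongr
      _ = _ := by rw [mul_one]
  have hmR : (0 : ℝ) < (4 * c * g : ℕ) := by positivity
  obtain ⟨f, hf⟩ := exists_pos_of_expect_pos (fun f : V → Fin N =>
      (∑ v ∈ L, ∑ T ∈ (nbrIn G W v).powersetCard s,
        if (∀ x ∈ T, f x = 0) ∧ ∀ x ∈ bad v T, f x ≠ 0 then (1 : ℝ) else 0) -
      1 / (4 * c * g : ℕ) * (∑ u ∈ L, ∑ v ∈ nbrIn G L u,
      ∑ T₁ ∈ (nbrIn G W u).powersetCard s, ∑ T₂ ∈ (nbrIn G W v).powersetCard s,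
        if ∀ x ∈ T₁ ∪ T₂, f x = 0 then (1 : ℝ) else 0) -
      β * ∑ x ∈ W, if ∀ z ∈ ({x} : Finset V), f z = 0 then (1 : ℝ) else 0) (by
    rw [Finset.expect_sub_distrib, Finset.expect_sub_distrib, ← Finset.mul_expect,
      ← Finset.mul_expect, hE3]
    have hcast : (8 ^ s * 2 * s.factorial : ℝ) = g := by rw [hg]; push_cast; ring
    rw [hcast] at hE1
    have e1 : (L.card * ((s + 1) * y ^ s * ((2 ^ s * s + (2 * s) ^ s) + (4 * k : ℕ) * y ^ s)) : ℝ) ≤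
        L.card * y ^ s * c := by
      have : (c : ℝ) = (s + 1) * ((2 ^ s * s + (2 * s) ^ s) + 4) := by rw [hc]; push_cast; ring
      rw [this]
      calc _ ≤ (L.card * ((s + 1) * y ^ s * ((2 ^ s * s + (2 * s) ^ s) + 4)) : ℝ) := by gcongr
        _ = _ := by ring
    have e2 := mul_le_mul_of_nonneg_left (hE2.trans e1) (one_div_nonneg.2 hmR.le)
    have e3 : 1 / ((4 * c * g : ℕ) : ℝ) * (L.card * y ^ s * c) = L.card * y ^ s / (4 * g) := by
      push_cast
      field_simp
    have e4 : L.card * (y ^ s / g) = 4 * (L.card * y ^ s / (4 * g)) := by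
      field_simp
    have e5 : 0 < L.card * y ^ s / (4 * g) := by positivity
    linarith)
  let S := L.filter (fun v => ∃ T ∈ (nbrIn G W v).powersetCard s,
    (∀ x ∈ T, f x = 0) ∧ ∀ x ∈ bad v T, f x ≠ 0)
  let A := W.filter (fun x => f x = 0)
  have hA : ∀ x, x ∈ A ↔ x ∈ W ∧ f x = 0 := fun x => by simp [A]
  have hT : ∀ v T, T ∈ (nbrIn G W v).powersetCard s → (∀ x ∈ T, f x = 0) →
      (∀ x ∈ bad v T, f x ≠ 0) → T = nbrIn G A v := by
    intro v T hT h1 h2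
    have hTW := (Finset.mem_powersetCard.1 hT).1
    ext x
    rw [mem_nbrIn, hA]
    constructor
    · intro hx
      have := mem_nbrIn.1 (hTW hx)
      exact ⟨⟨this.1, h1 x hx⟩, this.2⟩
    · rintro ⟨⟨hxW, hx0⟩, hvx⟩
      by_contra hxT
      refine h2 x ?_ hx0
      simp only [bad, Finset.mem_sdiff, Finset.mem_union, Finset.mem_insert, mem_nbrIn]
      exact ⟨Or.inl (Or.inr ⟨hxW, hvx⟩), hxT⟩
  have hS1 : (∑ v ∈ L, ∑ T ∈ (nbrIn G W v).powersetCard s,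
        if (∀ x ∈ T, f x = 0) ∧ ∀ x ∈ bad v T, f x ≠ 0 then (1 : ℝ) else 0) ≤ S.card := by
    have : (S.card : ℝ) = ∑ v ∈ L, if ∃ T ∈ (nbrIn G W v).powersetCard s,
        (∀ x ∈ T, f x = 0) ∧ ∀ x ∈ bad v T, f x ≠ 0 then (1 : ℝ) else 0 := by
      rw [Finset.sum_boole]
    rw [this]
    refine Finset.sum_le_sum (fun v _ => ?_)
    rw [Finset.sum_boole]
    split_ifs with hex
    · have : ((nbrIn G W v).powersetCard s).filter
          (fun T => (∀ x ∈ T, f x = 0) ∧ ∀ x ∈ bad v T, f x ≠ 0) ⊆ {nbrIn G A v} := by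
        intro T hT'
        rw [Finset.mem_filter] at hT'
        rw [Finset.mem_singleton]
        exact hT v T hT'.1 hT'.2.1 hT'.2.2
      have := Finset.card_le_card this
      rw [Finset.card_singleton] at this
      exact_mod_cast this
    · rw [Finset.filter_false_of_mem]
      · simp
      · exact fun T hT' h' => hex ⟨T, hT', h'⟩
  have hS2 := degSum_le_conflicts (G := G) (s := s) (W := W) (Finset.filter_subset _ L : S ⊆ L) f
    (fun v hv => by
      obtain ⟨T, hT1, hT2, -⟩ := (Finset.mem_filter.1 hv).2
      exact ⟨T, hT1, hT2⟩)
  have hS3 : (∑ x ∈ W, if ∀ z ∈ ({x} : Finset V), f z = 0 then (1 : ℝ) else 0) = A.card := by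
    simp only [Finset.mem_singleton, forall_eq]
    rw [Finset.sum_boole]
  rw [hS3] at hf
  have hmul := mul_le_mul_of_nonneg_left hS2 (one_div_nonneg.2 hmR.le)
  have hdeg0 : (0 : ℝ) ≤ 1 / (4 * c * g : ℕ) * (degSum G S : ℝ) := by positivity
  have hA0 : (0 : ℝ) ≤ β * (A.card : ℝ) := by positivity
  refine ⟨S, A, Finset.filter_subset _ _, ?_, ?_, ?_⟩
  · have : 1 / (4 * c * g : ℕ) * (degSum G S : ℝ) ≤ S.card := by linarith
    rw [one_div_mul_eq_div, div_le_iff₀ hmR] at this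
    rw [mul_comm]
    exact_mod_cast this
  · have : β * (A.card : ℝ) < S.card := by linarith
    exact_mod_cast this
  · intro v hv
    obtain ⟨T, hT1, hT2, hT3⟩ := (Finset.mem_filter.1 hv).2
    have hTA := hT v T hT1 hT2 hT3
    rw [← hTA]
    have hTs := (Finset.mem_powersetCard.1 hT1).2
    refine ⟨?_, hTs, ?_⟩
    · intro hvA
      by_cases hvT : v ∈ T
      · exact (mem_nbrIn.1 ((Finset.mem_powersetCard.1 hT1).1 hvT)).2.ne rfl
      · exact hT3 v (by simp [bad, hvT]) ((hA v).1 hvA).2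
    · intro w hw
      rw [← hTs]
      refine Finset.card_le_card (fun x hx => ?_)
      rw [Finset.mem_inter, hA] at hx
      by_contra hxT
      refine hT3 x ?_ hx.2.2
      simp only [bad, Finset.mem_sdiff, Finset.mem_union, Finset.mem_biUnion]
      exact ⟨Or.inr ⟨w, hw, hx.1⟩, hxT⟩

end SparseSample

section ShadowGraph

variable {V : Type}

/-- The graph joining two distinct vertices that are common members of some set `T v`, `v ∈ S`. -/
def shadow (S : Finset V) (T : V → Finset V) : SimpleGraph V where
  Adj x y := x ≠ y ∧ ∃ v ∈ S, x ∈ T v ∧ y ∈ T v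
  symm := ⟨fun _ _ ⟨h, v, hv, hx, hy⟩ => ⟨h.symm, v, hv, hy, hx⟩⟩
  loopless := ⟨fun _ h => h.1 rfl⟩

lemma card_le_of_shadow_degenerate [Fintype V] {S A : Finset V} {T : V → Finset V} {s D : ℕ}
    (hTA : ∀ v ∈ S, T v ⊆ A) (hTne : ∀ v ∈ S, (T v).Nonempty)
    (hfib : ∀ X : Finset V, (S.filter (fun v => T v = X)).card ≤ s)
    (h : ∀ W : Finset V, W.Nonempty → ∃ v ∈ W, (nbrIn (shadow S T) W v).card ≤ D) :
    S.card ≤ s * (A.card * 2 ^ D) := by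
  obtain ⟨out, hout, hcl⟩ := exists_out (shadow S T) D h
  have h1 : S.card ≤ s * (S.image T).card :=
    Finset.card_le_mul_card_image _ _ (fun X _ => hfib X)
  have h2 : S.image T ⊆ (A.sigma (fun w => (out w).powerset)).image (fun p => insert p.1 p.2) := by
    intro X hX
    obtain ⟨v, hv, rfl⟩ := Finset.mem_image.1 hX
    obtain ⟨w, hw, hws⟩ := hcl (T v) (hTne v hv) (fun x hx y hy hxy => ⟨hxy, v, hv, hx, hy⟩)
    rw [Finset.mem_image]
    refine ⟨⟨w, (T v).erase w⟩, ?_, Finset.insert_erase hw⟩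
    simp only [Finset.mem_sigma, Finset.mem_powerset]
    exact ⟨hTA v hv hw, hws⟩
  have h3 : (A.sigma (fun w => (out w).powerset)).card ≤ A.card * 2 ^ D := by
    rw [Finset.card_sigma, ← smul_eq_mul]
    refine Finset.sum_le_card_nsmul _ _ _ (fun w _ => ?_)
    rw [Finset.card_powerset]
    exact Nat.pow_le_pow_right (by norm_num) (hout w)
  exact h1.trans (Nat.mul_le_mul_left _ ((Finset.card_le_card h2).trans
    (Finset.card_image_le.trans h3)))

/-- The edges of `Q` with both ends in `W`. -/
abbrev EdgesIn (Q : SimpleGraph V) (W : Finset V) : Type :=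
  {e : Sym2 V // e ∈ Q.edgeSet ∧ ∀ x ∈ e, x ∈ W}

lemma degSum_le_two_mul_card_edgesIn [Fintype V] (Q : SimpleGraph V) (W : Finset V) :
    degSum Q W ≤ 2 * Fintype.card (EdgesIn Q W) := by
  have h1 : degSum Q W = (W.sigma (fun x => nbrIn Q W x)).card := by
    rw [Finset.card_sigma]
    rfl
  rw [h1, ← Finset.card_univ]
  have hmem : ∀ p ∈ W.sigma (fun x => nbrIn Q W x),
      s(p.1, p.2) ∈ Q.edgeSet ∧ ∀ x ∈ s(p.1, p.2), x ∈ W := by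
    rintro ⟨x, y⟩ hp
    rw [Finset.mem_sigma, mem_nbrIn] at hp
    refine ⟨hp.2.2, fun z hz => ?_⟩
    rcases Sym2.mem_iff.1 hz with rfl | rfl
    · exact hp.1
    · exact hp.2.1
  have h2 : ((W.sigma (fun x => nbrIn Q W x)).image (fun p => s(p.1, p.2))).card ≤
      (Finset.univ : Finset (EdgesIn Q W)).card := by
    rw [← Finset.card_map (Function.Embedding.subtype _)]
    refine Finset.card_le_card (fun e he => ?_)
    obtain ⟨p, hp, rfl⟩ := Finset.mem_image.1 he
    rw [Finset.mem_map]
    exact ⟨⟨_, hmem p hp⟩, Finset.mem_univ _, rfl⟩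
  refine le_trans (Finset.card_le_mul_card_image (f := fun p => s(p.1, p.2)) _ 2 ?_)
    (Nat.mul_le_mul_left _ h2)
  intro e _
  induction e using Sym2.ind with
  | _ x y =>
    refine le_trans (Finset.card_le_card (t := {⟨x, y⟩, ⟨y, x⟩}) ?_) Finset.card_le_two
    rintro ⟨a, b⟩ hab
    have hab := (Finset.mem_filter.1 hab).2
    simp only [Finset.mem_insert, Finset.mem_singleton, Sigma.mk.injEq, heq_eq_eq]
    exact Sym2.eq_iff.1 hab

/-- A dense graph without large bicliques contains a dense induced model. -/
lemma exists_inducedModel_of_not_hasBiclique (s : ℕ) (hs : 1 ≤ s) (D' : ℕ) : ∃ k₀ : ℕ,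
    ∀ {V : Type} [Fintype V] (G : SimpleGraph V), ¬ HasBiclique G s → ∀ W : Finset V,
    k₀ * W.card < degSum G W →
    ∃ (ι : Type) (A : Finset V) (J : Finset ι) (a b : ι → V) (I : ι → Set V),
      InducedModel G (A : Set V) (J : Set ι) a b I ∧ D' * A.card < J.card := by
  obtain ⟨m, hm⟩ := exists_sparse_sample s hs
  obtain ⟨D, hD⟩ := exists_inducedModel_of_dense (s + 2 * m) 1 (s * s) D'
  obtain ⟨K, hK⟩ := hm (2 * (s * 2 ^ (2 * D)))
  refine ⟨2 * K, ?_⟩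
  intro V _ G hG W₀ hW₀
  obtain ⟨k, W, hKk, hWne, hdegen, hmin⟩ := exists_extremal_subset hW₀
  obtain ⟨L, hLW, hWL, hL⟩ := exists_bounded_degree_half (hdegen W)
  obtain ⟨out, hout, hcl⟩ := exists_out G (2 * k)
    (fun W' hW' => exists_low_degree hW' (hdegen W'))
  have hLne : L.Nonempty := by
    rw [← Finset.card_pos]
    have := hWne.card_pos
    omega
  obtain ⟨S₀, A, hSL, hdeg, hβ, hgood₀⟩ := hK G hG k hKk W L out hLW hWL hLne
    (fun v hv => hmin v (hLW hv)) (fun v hv => (hL v hv).trans (by omega)) hout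
  obtain ⟨S, hSS, hSc, hSdeg⟩ := exists_bounded_degree_half hdeg
  have hgood : ∀ v ∈ S, v ∉ A ∧ (nbrIn G A v).card = s ∧
      ∀ w ∈ nbrIn G A v, (out w ∩ A).card ≤ s := fun v hv => hgood₀ v (hSS hv)
  obtain ⟨Q, hQ⟩ : ∃ Q, Q = shadow S (nbrIn G A) := ⟨_, rfl⟩
  have hQW : ∃ W' : Finset V, W'.Nonempty ∧ ∀ v ∈ W', 2 * D < (nbrIn Q W' v).card := by
    by_contra! hcon
    have := card_le_of_shadow_degenerate (S := S) (A := A) (T := nbrIn G A) (s := s) (D := 2 * D)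
      (fun v _ => Finset.filter_subset _ _)
      (fun v hv => by
        rw [← Finset.card_pos, (hgood v hv).2.1]
        exact hs)
      (fun X => by
        by_contra hlt
        push Not at hlt
        obtain ⟨Y, hY, hYs⟩ := Finset.exists_subset_card_eq hlt.le
        have hYne : Y.Nonempty := by
          rw [← Finset.card_pos]
          omega
        obtain ⟨y, hy⟩ := hYne
        have hy' := Finset.mem_filter.1 (hY hy)
        refine hG ⟨Y, X, hYs, ?_, fun v hv w hw => ?_⟩
        · rw [← hy'.2]
          exact (hgood y hy'.1).2.1
        · have hv' := Finset.mem_filter.1 (hY hv)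
          rw [← hv'.2] at hw
          exact (mem_nbrIn.1 hw).2)
      (by rwa [← hQ])
    nlinarith
  obtain ⟨W', hW'ne, hW'⟩ := hQW
  have hW'T : ∀ w ∈ W', ∃ v ∈ S, w ∈ nbrIn G A v := by
    intro w hw
    have h1 := hW' w hw
    obtain ⟨x, hx⟩ := Finset.card_pos.1 (Nat.zero_lt_of_lt h1)
    have h2 := (mem_nbrIn.1 hx).2
    rw [hQ] at h2
    obtain ⟨-, v, hv, hw', -⟩ := h2
    exact ⟨v, hv, hw'⟩
  have hW'A : ∀ w ∈ W', w ∈ A := by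
    intro w hw
    obtain ⟨v, -, h⟩ := hW'T w hw
    exact (mem_nbrIn.1 h).1
  have hab : ∀ e : EdgesIn Q W', ∃ x y v : V, s(x, y) = e.1 ∧ x ∈ W' ∧ y ∈ W' ∧ x ≠ y ∧ v ∈ S ∧
      x ∈ nbrIn G A v ∧ y ∈ nbrIn G A v := by
    rintro ⟨e, he, heW⟩
    induction e using Sym2.ind with
    | _ x y =>
      rw [mem_edgeSet, hQ] at he
      obtain ⟨hne, v, hv, hx, hy⟩ := he
      exact ⟨x, y, v, rfl, heW x (by simp), heW y (by simp), hne, hv, hx, hy⟩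
  choose a b c hab_eq ha hb hab_ne hc hac hbc using hab
  let out' : V → Finset V := fun x =>
    if x ∈ S then nbrIn G A x ∪ nbrIn G S₀ x else if x ∈ W' then out x ∩ A else ∅
  have hout'S : ∀ x ∈ S, out' x = nbrIn G A x ∪ nbrIn G S₀ x := fun x hx => if_pos hx
  have hSA : ∀ w ∈ W', w ∉ S := fun w hw hwS => (hgood w hwS).1 (hW'A w hw)
  have hout'W : ∀ w ∈ W', out' w = out w ∩ A := fun w hw => by
    simp only [out', if_neg (hSA w hw), if_pos hw]
  suffices key : ∃ (A' : Finset V) (J : Finset (EdgesIn Q W')),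
      InducedModel G (A' : Set V) (J : Set (EdgesIn Q W')) a b
        (fun e => (({c e} : Finset V) : Set V)) ∧ D' * A'.card < J.card by
    obtain ⟨A', J, M, hAJ⟩ := key
    exact ⟨_, A', J, a, b, _, M, hAJ⟩
  refine hD G W' a b (fun e => {c e}) out' ?_ ?_ ha hb hab_ne ?_ ?_ ?_ ?_ ?_ ?_
  · intro v
    simp only [out']
    split_ifs with h1 h2
    · refine (Finset.card_union_le _ _).trans ?_
      rw [(hgood v h1).2.1]
      exact Nat.add_le_add_left (hSdeg v h1) _
    · obtain ⟨u, hu, hvu⟩ := hW'T v h2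
      exact ((hgood u hu).2.2 v hvu).trans (Nat.le_add_right _ _)
    · simp
  · have hcase : ∀ x, (x ∈ W' ∨ ∃ i, x ∈ ({c i} : Finset V)) → x ∈ W' ∨ x ∈ S := by
      rintro x (h | ⟨i, h⟩)
      · exact Or.inl h
      · rw [Finset.mem_singleton] at h
        exact Or.inr (h ▸ hc i)
    intro x y hx hy hxy
    rcases hcase x hx with hx | hx
    · rcases hcase y hy with hy | hy
      · rw [hout'W x hx, hout'W y hy, Finset.mem_inter, Finset.mem_inter]
        have h1 := hW'A x hx
        have h2 := hW'A y hy
        have h3 := exists_out_adj hcl hxy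
        tauto
      · right
        rw [hout'S y hy, Finset.mem_union, mem_nbrIn]
        exact Or.inl ⟨hW'A x hx, hxy.symm⟩
    · left
      rw [hout'S x hx, Finset.mem_union, mem_nbrIn, mem_nbrIn]
      rcases hcase y hy with hy | hy
      · exact Or.inl ⟨hW'A y hy, hxy⟩
      · exact Or.inr ⟨hSS hy, hxy⟩
  · intro i j hij
    rw [hab_eq, hab_eq] at hij
    exact Subtype.ext hij
  · intro i
    simp
  · intro i x hx hxW
    rw [Finset.mem_singleton] at hx
    subst hx
    exact hSA _ hxW (hc i)
  · intro x
    by_cases hx : x ∈ S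
    · have h1 : (nbrIn G A x ×ˢ nbrIn G A x).card = s * s := by
        rw [Finset.card_product, (hgood x hx).2.1]
      rw [← h1]
      refine Finset.card_le_card_of_injOn (fun i => (a i, b i)) ?_ ?_
      · intro i hi
        simp only [Finset.coe_filter, Finset.mem_univ, true_and, Finset.mem_singleton,
          Set.mem_ofPred_eq] at hi
        subst hi
        simp only [Finset.coe_product, Set.mem_prod, Finset.mem_coe]
        exact ⟨hac i, hbc i⟩
      · intro i _ j _ hij
        simp only [Prod.mk.injEq] at hij
        apply Subtype.ext
        rw [← hab_eq, ← hab_eq, hij.1, hij.2]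
    · rw [Finset.filter_false_of_mem]
      · simp
      · intro i _ hi
        rw [Finset.mem_singleton] at hi
        exact hx (hi ▸ hc i)
  · intro i
    exact ((Linked.of_adj (mem_nbrIn.1 (hac i)).2.symm).trans
      (Linked.of_adj (mem_nbrIn.1 (hbc i)).2) (by simp))
  · have h1 := degSum_le_two_mul_card_edgesIn Q W'
    have h2 : W'.card * (2 * D + 1) ≤ degSum Q W' := by
      unfold degSum
      rw [← smul_eq_mul]
      exact Finset.card_nsmul_le_sum _ _ _ (fun v hv => hW' v hv)
    have h3 := hW'ne.card_pos
    nlinarith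

end ShadowGraph

lemma card_le_omegaNum {n : ℕ} (G : SimpleGraph (Fin n)) (S : Finset (Fin n))
    (hS : ∀ x ∈ S, ∀ y ∈ S, x ≠ y → G.Adj x y) : S.card ≤ omegaNum G := by
  refine le_csSup ⟨n, ?_⟩ ?_
  · rintro m ⟨f, hf⟩
    simpa using Fintype.card_le_of_injective f hf
  · let g := S.equivFin.symm
    have hg : ∀ i j, i ≠ j → (g i : Fin n) ≠ g j := fun i j hij h =>
      hij (g.injective (Subtype.ext h))
    refine ⟨⟨fun i => (g i : Fin n), fun {i j} hij => ?_⟩, ?_⟩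
    · exact hS _ (g i).2 _ (g j).2 (hg i j hij)
    · intro i j hij
      by_contra h
      exact hg i j h hij

lemma exists_not_hasBiclique (r κ : ℕ) : ∃ s : ℕ, 1 ≤ s ∧ ∀ {n : ℕ} (G : SimpleGraph (Fin n)),
    omegaNum G = κ → ¬ IsInducedSubgraphOf (completeBipartiteGraph (Fin r) (Fin r)) G →
    ¬ HasBiclique G s := by
  obtain ⟨R, hR⟩ := exists_clique_or_indep (κ + 1) r
  refine ⟨max R 1, le_max_right _ _, ?_⟩
  rintro n G hκ hfree ⟨S, T, hS, hT, hST⟩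
  have hindep : ∀ X : Finset (Fin n), X.card = max R 1 →
      ∃ Y ⊆ X, Y.card = r ∧ ∀ x ∈ Y, ∀ y ∈ Y, ¬ G.Adj x y := by
    intro X hX
    rcases hR G X (hX ▸ le_max_left _ _) with ⟨Y, -, hY, hcl⟩ | h
    · have := card_le_omegaNum G Y hcl
      omega
    · exact h
  obtain ⟨S', hS'S, hS', hSi⟩ := hindep S hS
  obtain ⟨T', hT'T, hT', hTi⟩ := hindep T hT
  let g := (S'.equivFinOfCardEq hS').symm
  let h := (T'.equivFinOfCardEq hT').symm
  have hgh : ∀ i j, G.Adj (g i : Fin n) (h j) := fun i j =>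
    hST _ (hS'S (g i).2) _ (hT'T (h j).2)
  refine hfree ⟨⟨⟨Sum.elim (fun i => (g i : Fin n)) (fun j => (h j : Fin n)), ?_⟩, ?_⟩⟩
  · refine Function.Injective.sumElim (Subtype.val_injective.comp g.injective)
      (Subtype.val_injective.comp h.injective) (fun i j => (hgh i j).ne)
  · rintro (i | i) (j | j)
    · simpa using hSi _ (g i).2 _ (g j).2
    · simpa using hgh i j
    · simpa using (hgh j i).symm
    · simpa using hTi _ (h i).2 _ (h j).2

noncomputable instance {n : ℕ} (H : SimpleGraph (Fin n)) : Fintype (Edges H) :=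
  inferInstanceAs (Fintype {p : Fin n × Fin n // p.1 < p.2 ∧ H.Adj p.1 p.2})

lemma ncard_edgeSet_le {n : ℕ} (H : SimpleGraph (Fin n)) :
    H.edgeSet.ncard ≤ Fintype.card (Edges H) := by
  have hsub : H.edgeSet ⊆ Set.range (fun e : Edges H => s(e.1.1, e.1.2)) := by
    intro e he
    induction e using Sym2.ind with
    | _ x y =>
      have hxy : H.Adj x y := he
      rcases lt_or_gt_of_ne hxy.ne with h | h
      · exact ⟨⟨(x, y), h, hxy⟩, rfl⟩
      · exact ⟨⟨(y, x), h, hxy.symm⟩, Sym2.eq_swap⟩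
  refine (Set.ncard_le_ncard hsub).trans ?_
  rw [← Set.image_univ]
  refine (Set.ncard_image_le).trans ?_
  simp [Set.ncard_univ]

/-- The ends of a subdivided edge are linked through its subdivision vertices. -/
lemma Subdiv.linked {n : ℕ} {H : SimpleGraph (Fin n)} {t : Edges H → ℕ} (e : Edges H) :
    Linked (Subdiv H t) {x | ∃ i, x = Sum.inr ⟨e, i⟩} (Sum.inl e.1.1) (Sum.inl e.1.2) := by
  by_cases h0 : t e = 0
  · refine Linked.of_adj ?_
    rw [Subdiv, fromRel_adj]
    refine ⟨fun h => e.2.1.ne (Sum.inl_injective h), Or.inl ⟨e.2, h0⟩⟩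
  have hstart : ∀ (k : ℕ) (hk : k < t e), Linked (Subdiv H t) {x | ∃ i, x = Sum.inr ⟨e, i⟩}
      (Sum.inl e.1.1) (Sum.inr ⟨e, ⟨k, hk⟩⟩) := by
    intro k
    induction k with
    | zero =>
      intro hk
      refine Linked.of_adj ?_
      rw [Subdiv, fromRel_adj]
      exact ⟨by simp, Or.inl (Or.inl ⟨rfl, rfl⟩)⟩
    | succ k ih =>
      intro hk
      refine (ih (by omega)).trans (Linked.of_adj ?_) ⟨_, rfl⟩
      rw [Subdiv, fromRel_adj]
      exact ⟨by simp, Or.inl ⟨rfl, rfl⟩⟩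
  refine (hstart (t e - 1) (by omega)).trans (Linked.of_adj ?_) ⟨_, rfl⟩
  rw [Subdiv, fromRel_adj]
  refine ⟨by simp, Or.inr (Or.inr ⟨rfl, ?_⟩)⟩
  show t e - 1 + 1 = t e
  omega

lemma Linked.map {V W : Type} {G : SimpleGraph V} {K : SimpleGraph W} {X : Set V} {u v : V}
    (f : G →g K) (h : Linked G X u v) : Linked K (f '' X) (f u) (f v) := by
  obtain ⟨p, hp⟩ := h
  refine ⟨p.map f, fun x hx => ?_⟩
  rw [Walk.support_map, List.mem_map] at hx
  obtain ⟨y, hy, rfl⟩ := hx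
  rcases hp y hy with rfl | rfl | h
  · exact Or.inl rfl
  · exact Or.inr (Or.inl rfl)
  · exact Or.inr (Or.inr ⟨y, h, rfl⟩)

/-- A dense shallow topological minor of a sparse graph yields a dense induced model. -/
lemma exists_inducedModel_of_memTM (d q D' : ℕ) : ∃ D : ℕ, ∀ {V : Type} [Fintype V]
    (G : SimpleGraph V) (out : V → Finset V), (∀ v, (out v).card ≤ d) →
    (∀ x y, G.Adj x y → y ∈ out x ∨ x ∈ out y) →
    ∀ {m : ℕ} (K : SimpleGraph (Fin m)), MemTM q G K → D * m < Fintype.card (Edges K) →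
    ∃ (A : Finset V) (J : Finset (Edges K)) (a b : Edges K → V) (I : Edges K → Set V),
      InducedModel G (A : Set V) (J : Set (Edges K)) a b I ∧ D' * A.card < J.card := by
  obtain ⟨D, hD⟩ := exists_inducedModel_of_dense d q 1 D'
  refine ⟨D, ?_⟩
  intro V _ G out hout hcl m K ⟨t, ht, f, hf⟩ hdense
  let A : Finset V := Finset.univ.image (fun v : Fin m => f (Sum.inl v))
  let I : Edges K → Finset V := fun e => Finset.univ.image (fun i : Fin (t e) => f (Sum.inr ⟨e, i⟩))
  have hA : ∀ v, f (Sum.inl v) ∈ A := fun v => Finset.mem_image_of_mem _ (Finset.mem_univ _)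
  have hne : ∀ e : Edges K, f (Sum.inl e.1.1) ≠ f (Sum.inl e.1.2) := fun e h =>
    e.2.1.ne (Sum.inl_injective (hf h))
  have hI : ∀ e x, x ∈ I e ↔ ∃ i : Fin (t e), f (Sum.inr ⟨e, i⟩) = x := by
    intro e x
    simp [I]
  suffices key : ∃ (A' : Finset V) (J : Finset (Edges K)),
      InducedModel G (A' : Set V) (J : Set (Edges K)) (fun e => f (Sum.inl e.1.1))
        (fun e => f (Sum.inl e.1.2)) (fun e => (I e : Set V)) ∧ D' * A'.card < J.card by
    obtain ⟨A', J, M, hAJ⟩ := key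
    exact ⟨A', J, _, _, _, M, hAJ⟩
  refine hD G A _ _ I out hout (fun x y _ _ h => hcl x y h) (fun e => hA _) (fun e => hA _) hne
    ?_ ?_ ?_ ?_ ?_ ?_
  · rintro ⟨⟨x, y⟩, hxy⟩ ⟨⟨x', y'⟩, hxy'⟩ h
    rcases Sym2.eq_iff.1 h with ⟨h1, h2⟩ | ⟨h1, h2⟩
    · have h1 := Sum.inl_injective (hf h1)
      have h2 := Sum.inl_injective (hf h2)
      exact Subtype.ext (Prod.ext h1 h2)
    · have h1 : x = y' := Sum.inl_injective (hf h1)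
      have h2 : y = x' := Sum.inl_injective (hf h2)
      have h3 : x < y := hxy.1
      have h4 : x' < y' := hxy'.1
      rw [← h1, ← h2] at h4
      exact absurd h3 h4.asymm
  · intro e
    exact Finset.card_image_le.trans (by simpa using ht e)
  · intro e x hx hxA
    obtain ⟨i, rfl⟩ := (hI e x).1 hx
    obtain ⟨v, -, hv⟩ := Finset.mem_image.1 hxA
    exact Sum.inl_ne_inr (hf hv)
  · intro x
    refine Finset.card_le_one.2 (fun e he e' he' => ?_)
    obtain ⟨i, hi⟩ := (hI e x).1 (Finset.mem_filter.1 he).2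
    obtain ⟨j, hj⟩ := (hI e' x).1 (Finset.mem_filter.1 he').2
    have := Sum.inr_injective (hf (hi.trans hj.symm))
    exact congrArg Sigma.fst this
  · intro e
    refine ((Subdiv.linked e).map f).mono ?_
    rintro _ ⟨_, ⟨i, rfl⟩, rfl⟩
    exact Or.inr (Or.inr ((hI _ _).2 ⟨i, rfl⟩))
  · refine lt_of_le_of_lt (Nat.mul_le_mul_left _ (Finset.card_image_le.trans ?_)) hdense
    simp

lemma avgDeg_le_of_card_edges_le {m D : ℕ} {K : SimpleGraph (Fin m)}
    (h : Fintype.card (Edges K) ≤ D * m) : avgDeg K ≤ 2 * D := by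
  have h1 : (K.edgeSet.ncard : ℝ) ≤ D * m := by
    exact_mod_cast (ncard_edgeSet_le K).trans h
  rw [avgDeg]
  refine div_le_of_le_mul₀ (by positivity) (by positivity) ?_
  linarith

end Auxiliary

/-- For every graph `H` and positive integer `r`, the class of all graphs
that are `K_{r,r}`-free and contain no induced subdivision of `H` has `ω`-bounded
expansion. -/
theorem omegaBE_of_Krr_free_no_induced_subdivision
    (nH : ℕ) (H : SimpleGraph (Fin nH)) (r : ℕ) (hr : 1 ≤ r) :
    OmegaBoundedExpansion (fun n => {G : SimpleGraph (Fin n) |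
      ¬ IsInducedSubgraphOf (completeBipartiteGraph (Fin r) (Fin r)) G ∧
      ∀ t : Edges H → ℕ, ¬ IsInducedSubgraphOf (Subdiv H t) G}) := by
  obtain ⟨D', hD'⟩ := exists_induced_subdiv_of_dense H
  choose s hs hbic using exists_not_hasBiclique r
  choose k hk using fun κ => exists_inducedModel_of_not_hasBiclique (s κ) (hs κ) D'
  choose D hD using fun κ q => exists_inducedModel_of_memTM (k κ) q D'
  refine ⟨fun κ q => 2 * D κ q, ?_⟩
  rintro n G ⟨hfree, hsub⟩ q m K hK
  refine avgDeg_le_of_card_edges_le ?_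
  have hlow : ∀ W : Finset (Fin n), degSum G W ≤ k (omegaNum G) * W.card := by
    intro W
    by_contra hW
    obtain ⟨ι, A, J, a, b, I, M, hAJ⟩ :=
      hk (omegaNum G) G (hbic _ G rfl hfree) W (not_le.1 hW)
    obtain ⟨t, ht⟩ := hD' M hAJ
    exact hsub t ht
  obtain ⟨out, hout, hcl⟩ := exists_out G (k (omegaNum G))
    (fun W hW => exists_low_degree hW (hlow W))
  by_contra hcon
  obtain ⟨A, J, a, b, I, M, hAJ⟩ := hD (omegaNum G) q G out hout
    (fun x y hxy => exists_out_adj hcl hxy) K hK (not_le.1 hcon)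
  obtain ⟨t, ht⟩ := hD' M hAJ
  exact hsub t ht
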